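/- arXiv:2011.06614 — 6 statements merged into one kernel-verified Lean document; each statement's English description precedes it below -/
import Mathlib

section
/- Let t₀ < T be real numbers. Let ψ : [t₀,T] × ℝ → [0,∞) be a Carathéodory function (t ↦ ψ(t,x) is measurable for every x ∈ ℝ, and x ↦ ψ(t,x) is continuous for a.e. t) such that for every r > 0 there exists a nonnegative integrable function k_r on [t₀,T] with sup_{|x| ≤ r} ψ(t,x) ≤ k_r(t) for a.e. t ∈ [t₀,T]. Let g be integrable on [t₀,T] and let γ : [t₀,T] → [0,∞) be measurable and bounded, satisfying γ(t₂) − γ(t₁) + ∫_{t₁}^{t₂} ψ(t,γ(t)) dt ≤ ∫_{t₁}^{t₂} g(t) dt for all t₀ ≤ t₁ ≤ t₂ ≤ T. Then there exists an absolutely continuous function x on [t₀,T] with x(t₀) = γ(t₀), x′(t) = −ψ(t,x(t)) + g(t) for a.e. t ∈ [t₀,T], and γ(t) ≤ x(t) for all t ∈ [t₀,T]. -/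
open MeasureTheory Set

open Filter Topology intervalIntegral

/-- Picard iterates, starting from the constant `c`, of the delayed integral equation
`y t = c + ∫ s in a..t, f s (y (s - h))`. -/
noncomputable def delayedPicard (f : ℝ → ℝ → ℝ) (a c h : ℝ) : ℕ → ℝ → ℝ
  | 0 => fun _ => c
  | n + 1 => fun t => c + ∫ s in a..t, f s (delayedPicard f a c h n (s - h))

theorem continuous_delayedPicard {f : ℝ → ℝ → ℝ} {a c h : ℝ}
    (hf : ∀ y : ℝ → ℝ, Continuous y → Integrable fun t => f t (y t)) (n : ℕ) :
    Continuous (delayedPicard f a c h n) := by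
  induction n with
  | zero => exact continuous_const
  | succ n ih =>
    refine continuous_const.add (continuous_primitive (fun u v => ?_) a)
    exact (hf (fun s => delayedPicard f a c h n (s - h))
      (ih.comp (continuous_id.sub continuous_const))).intervalIntegrable

theorem delayedPicard_succ_eq {f : ℝ → ℝ → ℝ} {a c h : ℝ} (h_nonneg : 0 ≤ h)
    (hfa : ∀ t ≤ a, ∀ x, f t x = 0) (n : ℕ) :
    ∀ t ≤ a + n * h, delayedPicard f a c h (n + 1) t = delayedPicard f a c h n t := by
  induction n with
  | zero =>
    intro t ht
    have hta : t ≤ a := by simpa using ht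
    have : ∫ s in a..t, f s (delayedPicard f a c h 0 (s - h)) = ∫ s in a..t, (0 : ℝ) := by
      refine integral_congr fun s hs => hfa s ?_ _
      rw [uIcc_of_ge hta] at hs
      exact hs.2
    have h₁ : delayedPicard f a c h (0 + 1) t
      = c + ∫ s in a..t, f s (delayedPicard f a c h 0 (s - h)) := rfl
    rw [h₁, this]
    simp [delayedPicard]
  | succ n ih =>
    intro t ht
    have : ∫ s in a..t, f s (delayedPicard f a c h (n + 1) (s - h))
        = ∫ s in a..t, f s (delayedPicard f a c h n (s - h)) := by
      refine integral_congr fun s hs => ?_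
      have hs' : s ≤ max a t := hs.2
      have : s - h ≤ a + n * h := by
        have : max a t ≤ a + (n + 1) * h := by
          refine max_le ?_ (by exact_mod_cast ht)
          have : 0 ≤ ((n : ℝ) + 1) * h := by positivity
          linarith
        linarith
      simp only [ih _ this]
    exact congrArg (c + ·) this

/-- **Carathéodory's existence theorem** for a scalar equation whose right-hand side is dominated
by an integrable function and vanishes before the initial time. -/
theorem exists_caratheodory_solution {f : ℝ → ℝ → ℝ} {a b : ℝ} (hab : a < b) (c : ℝ) {K : ℝ → ℝ}
    (hf_meas : ∀ y : ℝ → ℝ, Continuous y → AEStronglyMeasurable fun t => f t (y t))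
    (hf_cont : ∀ᵐ t, Continuous (f t)) (hK : Integrable K)
    (hf_bound : ∀ᵐ t, ∀ x, |f t x| ≤ K t) (hfa : ∀ t ≤ a, ∀ x, f t x = 0) :
    ∃ x : ℝ → ℝ, Continuous x ∧ ∀ t ∈ Icc a b, x t = c + ∫ s in a..t, f s (x s) := by
  have hint (y : ℝ → ℝ) (hy : Continuous y) : Integrable fun t => f t (y t) :=
    hK.mono' (hf_meas y hy) (hf_bound.mono fun t ht => ht _)
  let h : ℕ → ℝ := fun n => (b - a) / (n + 1)
  have h_nonneg (n : ℕ) : 0 ≤ h n := div_nonneg (by linarith) (by positivity)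
  have h_lim : Tendsto h atTop (𝓝 0) := by
    have := (tendsto_one_div_add_atTop_nhds_zero_nat (𝕜 := ℝ)).const_mul (b - a)
    simpa [h, div_eq_mul_inv] using this
  let X : ℕ → ℝ → ℝ := fun n => delayedPicard f a c (h n) (n + 1)
  have hX_cont (n : ℕ) : Continuous (X n) := continuous_delayedPicard hint _
  have hX_delay_cont (n : ℕ) : Continuous fun s => X n (s - h n) :=
    (hX_cont n).comp (continuous_id.sub continuous_const)
  have hX_eq (n : ℕ) (t : ℝ) (ht : t ∈ Icc a b) :
      X n t = c + ∫ s in a..t, f s (X n (s - h n)) := by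
    have : ∫ s in a..t, f s (X n (s - h n))
        = ∫ s in a..t, f s (delayedPicard f a c (h n) n (s - h n)) := by
      refine integral_congr fun s hs => ?_
      rw [uIcc_of_le ht.1] at hs
      have hb : a + n * h n = b - h n := by
        simp only [h]; field_simp; ring
      simp only [X, delayedPicard_succ_eq (c := c) (h_nonneg n) hfa n (s - h n)
        (by linarith [hs.2, ht.2])]
    rw [this]
    rfl
  have hX_const (n : ℕ) (t : ℝ) (ht : t ≤ a) : X n t = c := by
    have : ∫ s in a..t, f s (delayedPicard f a c (h n) n (s - h n)) = ∫ s in a..t, (0 : ℝ) := by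
      refine integral_congr fun s hs => hfa s ?_ _
      rw [uIcc_of_ge ht] at hs
      exact hs.2
    simp only [X, delayedPicard, this]
    simp
  have hbound_int (y : ℝ → ℝ) (u v : ℝ) :
      |∫ s in u..v, f s (y s)| ≤ |∫ s in u..v, K s| :=
    norm_integral_le_abs_of_norm_le (f := fun s => f s (y s))
      (ae_restrict_of_ae (hf_bound.mono fun t ht => ht _)) hK.intervalIntegrable
  have hX_diff (n : ℕ) (u v : ℝ) (hu : u ∈ Icc a b) (hv : v ∈ Icc a b) :
      |X n u - X n v| ≤ |∫ s in u..v, K s| := by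
    have hi : Integrable fun s => f s (X n (s - h n)) := hint _ (hX_delay_cont n)
    have : X n u - X n v = - ∫ s in u..v, f s (X n (s - h n)) := by
      rw [hX_eq n u hu, hX_eq n v hv,
        ← integral_add_adjacent_intervals (hi.intervalIntegrable (a := a) (b := u))
          (hi.intervalIntegrable (b := v))]
      ring
    rw [this, abs_neg]
    exact hbound_int _ u v
  let Y : ℕ → BoundedContinuousFunction (Icc a b) ℝ := fun n =>
    BoundedContinuousFunction.mkOfCompact ⟨fun t => X n t, (hX_cont n).comp continuous_subtype_val⟩
  have hcompact : IsCompact (closure (range Y)) := by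
    refine BoundedContinuousFunction.arzela_ascoli (Metric.closedBall c (∫ s, ‖K s‖))
      (isCompact_closedBall _ _) _ ?_ ?_
    · rintro _ t ⟨n, rfl⟩
      have h₁ := hX_diff n t a t.2 (left_mem_Icc.2 hab.le)
      rw [hX_const n a le_rfl] at h₁
      rw [Metric.mem_closedBall, Real.dist_eq]
      refine h₁.trans ((norm_integral_le_integral_norm_uIoc (f := K)).trans ?_)
      exact setIntegral_le_integral hK.norm (Eventually.of_forall fun s => norm_nonneg _)
    · intro t
      refine Metric.equicontinuousAt_of_continuity_modulus
        (fun v : Icc a b => |∫ s in (t : ℝ)..v, K s|) ?_ _ (Eventually.of_forall ?_)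
      · have hc : Continuous fun v : Icc a b => |∫ s in (t : ℝ)..v, K s| :=
          ((continuous_primitive (fun u v => hK.intervalIntegrable) (t : ℝ)).comp
            continuous_subtype_val).abs
        simpa using hc.tendsto t
      · rintro v ⟨_, n, rfl⟩
        exact hX_diff n t v t.2 v.2
  obtain ⟨y, -, φ, hφ, hy⟩ :=
    hcompact.tendsto_subseq fun n => subset_closure (mem_range_self (f := Y) n)
  have hy_eval {u : ℕ → Icc a b} {v : Icc a b} (huv : Tendsto u atTop (𝓝 v)) :
      Tendsto (fun n => X (φ n) (u n)) atTop (𝓝 (y v)) :=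
    (continuous_eval.tendsto (y, v)).comp (hy.prodMk_nhds huv)
  have hproj : Continuous (projIcc a b hab.le) := continuous_projIcc
  refine ⟨fun t => y (projIcc a b hab.le t), y.continuous.comp hproj, fun t ht => ?_⟩
  have hlim₁ : Tendsto (fun n => X (φ n) t) atTop (𝓝 (y (projIcc a b hab.le t))) := by
    rw [projIcc_of_mem hab.le ht]
    exact hy_eval (u := fun _ => ⟨t, ht⟩) tendsto_const_nhds
  have hlim₂ : Tendsto (fun n => c + ∫ s in a..t, f s (X (φ n) (s - h (φ n)))) atTop
      (𝓝 (c + ∫ s in a..t, f s (y (projIcc a b hab.le s)))) := by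
    refine Tendsto.const_add c (tendsto_integral_filter_of_dominated_convergence K ?_ ?_
      hK.intervalIntegrable ?_)
    · exact Eventually.of_forall fun n => (hf_meas _ (hX_delay_cont (φ n))).restrict
    · exact Eventually.of_forall fun n => hf_bound.mono fun s hs _ => hs _
    · filter_upwards [hf_cont] with s hs hst
      rw [uIoc_of_le ht.1] at hst
      refine (hs.tendsto _).comp ?_
      have hdelay : Tendsto (fun n => projIcc a b hab.le (s - h (φ n))) atTop
          (𝓝 (projIcc a b hab.le s)) := by
        refine (hproj.tendsto s).comp ?_
        simpa using (h_lim.comp hφ.tendsto_atTop).const_sub s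
      refine (hy_eval hdelay).congr fun n => ?_
      have hle : s - h (φ n) ≤ b := by linarith [hst.2, ht.2, h_nonneg (φ n)]
      rcases le_total a (s - h (φ n)) with hge | hle'
      · rw [projIcc_of_mem hab.le ⟨hge, hle⟩]
      · rw [projIcc_of_le_left hab.le hle', hX_const _ _ le_rfl, hX_const _ _ hle']
  exact tendsto_nhds_unique (hlim₁.congr fun n => hX_eq (φ n) t ht) hlim₂

/-- Comparison principle: a function `γ` with `γ t₂ - γ t₁ ≤ ∫ s in t₁..t₂, q s` stays below a
continuous primitive of `p` if `p = q` wherever that primitive lies strictly below `γ`. -/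
theorem le_of_sub_le_integral {a b : ℝ} {x γ p q : ℝ → ℝ} (hx : Continuous x)
    (hxa : γ a ≤ x a) (hp : Integrable p) (hq : Integrable q)
    (hxp : ∀ t ∈ Icc a b, x t = x a + ∫ s in a..t, p s)
    (hγ : ∀ t₁ t₂, a ≤ t₁ → t₁ ≤ t₂ → t₂ ≤ b → γ t₂ - γ t₁ ≤ ∫ s in t₁..t₂, q s)
    (hpq : ∀ t ∈ Icc a b, x t < γ t → p t = q t) :
    ∀ t ∈ Icc a b, γ t ≤ x t := by
  intro t ht
  by_contra! hlt
  let S := {s | s ∈ Icc a t ∧ γ s ≤ x s}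
  have haS : a ∈ S := ⟨left_mem_Icc.2 ht.1, hxa⟩
  have hS_bdd : BddAbove S := ⟨t, fun s hs => hs.1.2⟩
  set τ := sSup S
  have haτ : a ≤ τ := le_csSup hS_bdd haS
  have hτt : τ ≤ t := csSup_le ⟨a, haS⟩ fun s hs => hs.1.2
  have hτb : τ ≤ b := hτt.trans ht.2
  have hpq_int : ∫ s in τ..t, p s = ∫ s in τ..t, q s := by
    refine integral_congr_ae (Eventually.of_forall fun s hs => ?_)
    rw [uIoc_of_le hτt] at hs
    refine hpq s ⟨haτ.trans hs.1.le, hs.2.trans ht.2⟩ ?_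
    by_contra! hle
    exact hs.1.not_ge (le_csSup hS_bdd ⟨⟨haτ.trans hs.1.le, hs.2⟩, hle⟩)
  have hτ_lt : x τ < γ τ := by
    have h₁ := hγ τ t haτ hτt ht.2
    have h₂ := integral_add_adjacent_intervals (hp.intervalIntegrable (a := a) (b := τ))
      (hp.intervalIntegrable (b := t))
    linarith [hxp t ht, hxp τ ⟨haτ, hτb⟩]
  have hclosed : IsClosed {s | γ τ - ∫ r in a..τ, q r ≤ x s - ∫ r in a..s, q r} :=
    isClosed_le continuous_const
      (hx.sub (continuous_primitive (fun u v => hq.intervalIntegrable) a))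
  have hsub : S ⊆ {s | γ τ - ∫ r in a..τ, q r ≤ x s - ∫ r in a..s, q r} := by
    intro s hs
    have h₁ := hγ s τ hs.1.1 (le_csSup hS_bdd hs) hτb
    have h₂ := integral_add_adjacent_intervals (hq.intervalIntegrable (a := a) (b := s))
      (hq.intervalIntegrable (b := τ))
    have h₃ : γ s ≤ x s := hs.2
    rw [mem_ofPred_eq]
    linarith
  have hτ_mem := closure_minimal hsub hclosed (csSup_mem_closure ⟨a, haS⟩ hS_bdd)
  rw [mem_ofPred_eq] at hτ_mem
  linarith



/-- **Existence of a dominating solution of a Cauchy problem (finite horizon).**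
Given a Carathéodory function `ψ : [t₀,T] × ℝ → ℝ₊` locally bounded by integrable
functions, an integrable `g`, and a measurable bounded `γ : [t₀,T] → ℝ₊` satisfying
`γ(t₂) − γ(t₁) + ∫_{t₁}^{t₂} ψ(t,γ(t)) dt ≤ ∫_{t₁}^{t₂} g(t) dt` for `t₀ ≤ t₁ ≤ t₂ ≤ T`,
there is an absolutely continuous `x` (i.e. `x(t) = x(t₀) + ∫_{t₀}^t x'` with `x'`
integrable) such that `x(t₀) = γ(t₀)`, `x' = −ψ(·,x) + g` a.e., and `γ ≤ x` on `[t₀,T]`. -/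
theorem stmt_0 (t₀ T : ℝ) (hT : t₀ < T)
    (ψ : ℝ → ℝ → ℝ)
    (hψ_nonneg : ∀ t ∈ Icc t₀ T, ∀ x : ℝ, 0 ≤ ψ t x)
    (hψ_meas : ∀ x : ℝ, Measurable fun t => ψ t x)
    (hψ_cont : ∀ᵐ t ∂(volume.restrict (Icc t₀ T)), Continuous fun x => ψ t x)
    (hψ_bound : ∀ r > (0 : ℝ), ∃ k : ℝ → ℝ,
      IntegrableOn k (Icc t₀ T) ∧ (∀ t ∈ Icc t₀ T, 0 ≤ k t) ∧
      ∀ᵐ t ∂(volume.restrict (Icc t₀ T)), ∀ x : ℝ, |x| ≤ r → ψ t x ≤ k t)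
    (g : ℝ → ℝ) (hg : IntegrableOn g (Icc t₀ T))
    (γ : ℝ → ℝ) (hγ_meas : Measurable γ)
    (hγ_nonneg : ∀ t ∈ Icc t₀ T, 0 ≤ γ t)
    (hγ_bdd : ∃ C : ℝ, ∀ t ∈ Icc t₀ T, γ t ≤ C)
    (hγ_ineq : ∀ t₁ t₂ : ℝ, t₀ ≤ t₁ → t₁ ≤ t₂ → t₂ ≤ T →
      γ t₂ - γ t₁ + ∫ t in t₁..t₂, ψ t (γ t) ≤ ∫ t in t₁..t₂, g t) :
    ∃ x x' : ℝ → ℝ,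
      IntegrableOn x' (Icc t₀ T) ∧
      (∀ t ∈ Icc t₀ T, x t = x t₀ + ∫ s in t₀..t, x' s) ∧
      x t₀ = γ t₀ ∧
      (∀ᵐ t ∂(volume.restrict (Icc t₀ T)), x' t = -ψ t (x t) + g t) ∧
      (∀ t ∈ Icc t₀ T, γ t ≤ x t) := by
  have hγ_le_int (t : ℝ) (ht : t ∈ Icc t₀ T) : γ t ≤ γ t₀ + ∫ s in t₀..t, g s := by
    have h₁ := hγ_ineq t₀ t le_rfl ht.1 ht.2
    have h₂ : 0 ≤ ∫ s in t₀..t, ψ s (γ s) :=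
      integral_nonneg ht.1 fun s hs => hψ_nonneg s ⟨hs.1, hs.2.trans ht.2⟩ _
    linarith
  have hg_int (t : ℝ) (ht : t ∈ Icc t₀ T) : IntervalIntegrable g volume t₀ t :=
    (intervalIntegrable_iff_integrableOn_Icc_of_le ht.1).2
      (hg.mono_set (Icc_subset_Icc_right ht.2))
  obtain ⟨R, hR_pos, hR⟩ : ∃ R > (0 : ℝ), ∀ t ∈ Icc t₀ T, γ t₀ + ∫ s in t₀..t, g s ≤ R := by
    have hc : ContinuousOn (fun t => γ t₀ + ∫ s in t₀..t, g s) (Icc t₀ T) := by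
      refine continuousOn_const.add ?_
      have := continuousOn_primitive_interval (f := g) (μ := volume) (a := t₀) (b := T)
        (by rwa [uIcc_of_le hT.le])
      rwa [uIcc_of_le hT.le] at this
    obtain ⟨R, hR⟩ := isCompact_Icc.bddAbove_image hc
    exact ⟨max R 1, by positivity, fun t ht =>
      (hR (mem_image_of_mem _ ht)).trans (le_max_left _ _)⟩
  obtain ⟨k, hk_int, -, hk⟩ := hψ_bound R hR_pos
  obtain ⟨E, hE_ae, hE_meas, hE⟩ := (hψ_cont.and hk).exists_measurable_mem
  let P : ℝ → ℝ → ℝ := fun x => (E ∩ Ioc t₀ T).indicator fun t => ψ t x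
  have hP_meas : Measurable (Function.uncurry P) := by
    refine measurable_uncurry_of_continuous_of_measurable (fun t => ?_) fun x =>
      (hψ_meas x).indicator (hE_meas.inter measurableSet_Ioc)
    by_cases ht : t ∈ E ∩ Ioc t₀ T
    · simpa [P, ht] using (hE t ht.1).1
    · simpa [P, ht] using continuous_const
  have hP_cont (t : ℝ) : Continuous fun x => P x t := by
    by_cases ht : t ∈ E ∩ Ioc t₀ T
    · simpa [P, ht] using (hE t ht.1).1
    · simpa [P, ht] using continuous_const
  let q : ℝ → ℝ := (Ioc t₀ T).indicator g
  let f : ℝ → ℝ → ℝ := fun t x => q t - P (max (γ t) (min x R)) t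
  let K : ℝ → ℝ := (Ioc t₀ T).indicator fun t => |g t| + k t
  have hq_int : Integrable q :=
    (integrable_indicator_iff measurableSet_Ioc).2 (hg.mono_set Ioc_subset_Icc_self)
  have hK_int : Integrable K :=
    (integrable_indicator_iff measurableSet_Ioc).2
      (IntegrableOn.mono_set (hg.norm.add hk_int) Ioc_subset_Icc_self)
  have hE_ae' : ∀ᵐ t, t ∈ Icc t₀ T → t ∈ E := (ae_restrict_iff' measurableSet_Icc).1 hE_ae
  have hne : ∀ᵐ t : ℝ, t ≠ t₀ := by simp [ae_iff]
  have hP_nonneg (t x : ℝ) : 0 ≤ P x t :=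
    indicator_nonneg (fun t ht => hψ_nonneg t (Ioc_subset_Icc_self ht.2) x) t
  have hf_bound (t x : ℝ) (htE : t ∈ Icc t₀ T → t ∈ E) : |f t x| ≤ K t := by
    by_cases ht : t ∈ Ioc t₀ T
    · have ht' := Ioc_subset_Icc_self ht
      have hmem : t ∈ E ∩ Ioc t₀ T := ⟨htE ht', ht⟩
      have h₁ : |max (γ t) (min x R)| ≤ R := by
        rw [abs_of_nonneg ((hγ_nonneg t ht').trans (le_max_left _ _))]
        exact max_le ((hγ_le_int t ht').trans (hR t ht')) (min_le_right _ _)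
      have h₂ := (hE t hmem.1).2 _ h₁
      have h₃ := hψ_nonneg t ht' (max (γ t) (min x R))
      simp only [f, K, q, P, indicator_of_mem ht, indicator_of_mem hmem]
      refine (abs_sub _ _).trans ?_
      rw [abs_of_nonneg h₃]
      linarith
    · simp [f, K, q, P, ht]
  have hf_zero (t : ℝ) (ht : t ≤ t₀) (x : ℝ) : f t x = 0 := by
    simp [f, q, P, ht.not_gt]
  have hf_meas (y : ℝ → ℝ) (hy : Measurable y) : AEStronglyMeasurable fun t => f t (y t) := by
    refine hq_int.aestronglyMeasurable.sub (Measurable.aestronglyMeasurable ?_)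
    exact hP_meas.comp ((hγ_meas.max (hy.min measurable_const)).prodMk measurable_id)
  have hf_int (y : ℝ → ℝ) (hy : Measurable y) : Integrable fun t => f t (y t) :=
    hK_int.mono' (hf_meas y hy) (hE_ae'.mono fun t ht => hf_bound t _ ht)
  have hf_eq (t x : ℝ) (ht : t ∈ Icc t₀ T) (htE : t ∈ E) (htne : t ≠ t₀) (hγx : γ t ≤ x)
      (hxR : x ≤ R) : f t x = -ψ t x + g t := by
    have hIoc : t ∈ Ioc t₀ T := ⟨lt_of_le_of_ne ht.1 htne.symm, ht.2⟩
    have hmem : t ∈ E ∩ Ioc t₀ T := ⟨htE, hIoc⟩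
    simp only [f, q, P, indicator_of_mem hIoc, indicator_of_mem hmem, min_eq_left hxR,
      max_eq_right hγx]
    ring
  have hγ_le (t : ℝ) (ht : t ∈ Icc t₀ T) : γ t ≤ R := (hγ_le_int t ht).trans (hR t ht)
  obtain ⟨x, hx_cont, hx⟩ := exists_caratheodory_solution hT (γ t₀)
    (fun y hy => hf_meas y hy.measurable)
    (Eventually.of_forall fun t => continuous_const.sub
      ((hP_cont t).comp (continuous_const.max (continuous_id.min continuous_const))))
    hK_int (hE_ae'.mono fun t ht x => hf_bound t x ht) hf_zero
  have hx₀ : x t₀ = γ t₀ := by simpa using hx t₀ (left_mem_Icc.2 hT.le)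
  have hx_le (t : ℝ) (ht : t ∈ Icc t₀ T) : x t ≤ R := by
    rw [hx t ht]
    refine le_trans (add_le_add_right ?_ _) (hR t ht)
    refine integral_mono_on_of_le_Ioo ht.1
      (hf_int x hx_cont.measurable).intervalIntegrable (hg_int t ht) fun s hs => ?_
    have hIoc : s ∈ Ioc t₀ T := ⟨hs.1, hs.2.le.trans ht.2⟩
    simp only [f, q, indicator_of_mem hIoc]
    linarith [hP_nonneg s (max (γ s) (min (x s) R))]
  have hγ_x : ∀ t ∈ Icc t₀ T, γ t ≤ x t := by
    refine le_of_sub_le_integral hx_cont hx₀.ge (hf_int x hx_cont.measurable)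
      (hf_int γ hγ_meas) (by rwa [hx₀]) ?_ ?_
    · intro t₁ t₂ h₁ h₁₂ h₂
      have hsub : Icc t₁ t₂ ⊆ Icc t₀ T := Icc_subset_Icc h₁ h₂
      have hg₁₂ : IntervalIntegrable g volume t₁ t₂ :=
        (intervalIntegrable_iff_integrableOn_Icc_of_le h₁₂).2 (hg.mono_set hsub)
      have heq : ∀ᵐ t, t ∈ uIoc t₁ t₂ → f t (γ t) = g t - ψ t (γ t) := by
        filter_upwards [hE_ae', hne] with t htE htne ht
        rw [uIoc_of_le h₁₂] at ht
        have ht' := hsub (Ioc_subset_Icc_self ht)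
        rw [hf_eq t _ ht' (htE ht') htne le_rfl (hγ_le t ht')]
        ring
      have hψγ : IntervalIntegrable (fun t => ψ t (γ t)) volume t₁ t₂ := by
        refine (hg₁₂.sub (hf_int γ hγ_meas).intervalIntegrable).congr_ae ?_
        refine (ae_restrict_iff' measurableSet_uIoc).2 (heq.mono fun t h ht => ?_)
        simp [h ht]
      rw [integral_congr_ae heq, integral_sub hg₁₂ hψγ]
      linarith [hγ_ineq t₁ t₂ h₁ h₁₂ h₂]
    · intro t ht hlt
      have hle : x t ≤ R := hx_le t ht
      simp only [f, min_eq_left hle, max_eq_left hlt.le, min_eq_left (hγ_le t ht), max_self]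
  refine ⟨x, fun t => f t (x t), (hf_int x hx_cont.measurable).integrableOn, by rwa [hx₀], hx₀,
    ?_, hγ_x⟩
  rw [ae_restrict_iff' measurableSet_Icc]
  filter_upwards [hE_ae', hne] with t htE htne ht
  exact hf_eq t _ ht (htE ht) htne (hγ_x t ht) (hx_le t ht)
end

section
/- Let t₀ ∈ ℝ. Let ψ : [t₀,∞) × ℝ → [0,∞) be a Carathéodory function (measurable in t for each x, continuous in x for a.e. t) such that for every T > t₀ and every r > 0 there exists a nonnegative integrable function k_r on [t₀,T] with sup_{|x| ≤ r} ψ(t,x) ≤ k_r(t) for a.e. t ∈ [t₀,T]. Let g be integrable on [t₀,∞) and let γ : [t₀,∞) → [0,∞) be measurable and locally bounded, satisfying γ(t₂) − γ(t₁) + ∫_{t₁}^{t₂} ψ(t,γ(t)) dt ≤ ∫_{t₁}^{t₂} g(t) dt for all t₀ ≤ t₁ ≤ t₂ < ∞. Then there exists a locally absolutely continuous function x on [t₀,∞) with x(t₀) = γ(t₀), x′(t) = −ψ(t,x(t)) + g(t) for a.e. t, and γ(t) ≤ x(t) for all t ≥ t₀; in particular limsup_{t→∞} γ(t) ≤ limsup_{t→∞}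 x(t). -/
open MeasureTheory Set Filter
open scoped Topology

/-- Composing a measurable, locally dominated function with a measurable function gives an
interval integrable function. -/
lemma intervalIntegrable_comp_of_dominated {f : ℝ → ℝ → ℝ}
    (hf : Measurable (Function.uncurry f))
    (hb : ∀ T, ∃ h : ℝ → ℝ, Integrable h ∧ ∀ᵐ t, t ≤ T → ∀ x, |f t x| ≤ h t)
    {u : ℝ → ℝ} (hu : Measurable u) (p q : ℝ) :
    IntervalIntegrable (fun s => f s (u s)) volume p q := by
  obtain ⟨h, hh, hbd⟩ := hb (max p q)
  refine hh.intervalIntegrable.mono_fun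
    (hf.comp (measurable_id.prodMk hu)).aestronglyMeasurable ?_
  filter_upwards [ae_restrict_of_ae hbd, ae_restrict_mem measurableSet_uIoc] with t ht htm
  exact (ht htm.2 (u t)).trans (le_abs_self _)

/-- A piecewise frozen Euler scheme with step `δ`. -/
lemma exists_euler_approximation {f : ℝ → ℝ → ℝ}
    (hf : Measurable (Function.uncurry f))
    (hb : ∀ T, ∃ h : ℝ → ℝ, Integrable h ∧ ∀ᵐ t, t ≤ T → ∀ x, |f t x| ≤ h t)
    (t₀ a : ℝ) {δ : ℝ} (hδ : 0 < δ) :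
    ∃ u τ : ℝ → ℝ, Measurable u ∧ ∀ s, t₀ ≤ s → τ s ≤ s ∧ s ≤ τ s + δ ∧ t₀ ≤ τ s ∧
      u s = a + ∫ r in t₀..τ s, f r (u r) := by
  let v : ℕ → ℝ := fun n => Nat.rec a
    (fun k w => w + ∫ r in (t₀ + δ * k)..(t₀ + δ * (k + 1)), f r w) n
  have hv : ∀ k, v (k + 1) = v k + ∫ r in (t₀ + δ * k)..(t₀ + δ * (k + 1)), f r (v k) :=
    fun k => rfl
  let u : ℝ → ℝ := fun s => v ⌊(s - t₀) / δ⌋₊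
  have hu : Measurable u := by
    refine (measurable_from_top (f := v)).comp (Nat.measurable_floor.comp ?_)
    fun_prop
  have key : ∀ k : ℕ, a + ∫ r in t₀..(t₀ + δ * k), f r (u r) = v k := by
    intro k
    induction k with
    | zero => simp [v]
    | succ k ih =>
      rw [← intervalIntegral.integral_add_adjacent_intervals
        (intervalIntegrable_comp_of_dominated hf hb hu t₀ (t₀ + δ * k))
        (intervalIntegrable_comp_of_dominated hf hb hu _ _), ← add_assoc, ih, hv]
      push_cast
      congr 1
      apply intervalIntegral.integral_congr_Ioo_of_le (by nlinarith)
      intro r hr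
      have : ⌊(r - t₀) / δ⌋₊ = k := by
        rw [Nat.floor_eq_iff]
        · constructor
          · rw [le_div_iff₀ hδ]; nlinarith [hr.1]
          · rw [div_lt_iff₀ hδ]; nlinarith [hr.2]
        · apply div_nonneg _ hδ.le
          have : 0 ≤ δ * (k : ℝ) := by positivity
          linarith [hr.1]
      simp only [u, this]
  refine ⟨u, fun s => t₀ + δ * ⌊(s - t₀) / δ⌋₊, hu, fun s hs => ⟨?_, ?_, ?_, ?_⟩⟩
  · have := Nat.floor_le (div_nonneg (sub_nonneg.2 hs) hδ.le)
    rw [le_div_iff₀ hδ] at this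
    linarith
  · have := (Nat.lt_floor_add_one ((s - t₀) / δ)).le
    rw [div_le_iff₀ hδ] at this
    linarith
  · have : 0 ≤ δ * (⌊(s - t₀) / δ⌋₊ : ℝ) := by positivity
    linarith
  · exact (key _).symm

/-- The continuous functions with a prescribed value at a point and prescribed moduli of
continuity on half-lines form a compact set. -/
lemma isCompact_setOf_modulus (H : ℝ → ℝ → ℝ) (hH : ∀ T, Continuous (H T)) (t₀ a : ℝ) :
    IsCompact {x : C(ℝ, ℝ) | x t₀ = a ∧
      ∀ T s t, s ≤ T → t ≤ T → |x t - x s| ≤ |H T t - H T s|} := by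
  have cont : ∀ t : ℝ, Tendsto (fun s => |H (t + 1) s - H (t + 1) t|) (𝓝 t) (𝓝 0) := by
    intro t
    have : Continuous fun s => |H (t + 1) s - H (t + 1) t| := by
      have := hH (t + 1)
      fun_prop
    simpa using this.tendsto t
  apply ArzelaAscoli.isCompact_of_equicontinuous
  · have himg : ContinuousMap.toFun '' {x : C(ℝ, ℝ) | x t₀ = a ∧
        ∀ T s t, s ≤ T → t ≤ T → |x t - x s| ≤ |H T t - H T s|} =
        {x : ℝ → ℝ | x t₀ = a ∧ ∀ T s t, s ≤ T → t ≤ T → |x t - x s| ≤ |H T t - H T s|} := by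
      ext x
      constructor
      · rintro ⟨y, hy, rfl⟩
        exact hy
      · intro hx
        refine ⟨⟨x, continuous_iff_continuousAt.2 fun t => ?_⟩, hx, rfl⟩
        rw [ContinuousAt, tendsto_iff_dist_tendsto_zero]
        refine squeeze_zero' (Eventually.of_forall fun _ => dist_nonneg) ?_ (cont t)
        filter_upwards [Iio_mem_nhds (lt_add_one t)] with s hs
        exact hx.2 (t + 1) t s (lt_add_one t).le (le_of_lt hs)
    rw [himg]
    refine IsCompact.of_isClosed_subset (isCompact_univ_pi fun t =>
      isCompact_closedBall a |H (max t t₀) t - H (max t t₀) t₀|) ?_ ?_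
    · apply IsClosed.inter (s₁ := {x : ℝ → ℝ | x t₀ = a})
        (s₂ := {x | ∀ T s t, s ≤ T → t ≤ T → |x t - x s| ≤ |H T t - H T s|})
      · exact isClosed_eq (continuous_apply _) continuous_const
      · have : {x : ℝ → ℝ | ∀ T s t, s ≤ T → t ≤ T → |x t - x s| ≤ |H T t - H T s|} =
            ⋂ (T : ℝ) (s : ℝ) (t : ℝ) (_ : s ≤ T) (_ : t ≤ T),
              {x : ℝ → ℝ | |x t - x s| ≤ |H T t - H T s|} := by
          ext x
          simp
        rw [this]
        refine isClosed_iInter fun T => isClosed_iInter fun s => isClosed_iInter fun t =>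
          isClosed_iInter fun _ => isClosed_iInter fun _ => ?_
        exact isClosed_le (by fun_prop) continuous_const
    · rintro x ⟨hx0, hx⟩ t -
      rw [Metric.mem_closedBall, Real.dist_eq, ← hx0]
      exact hx _ _ _ (le_max_right _ _) (le_max_left _ _)
  · intro t
    refine Metric.equicontinuousAt_of_continuity_modulus _ (cont t) _ ?_
    filter_upwards [Iio_mem_nhds (lt_add_one t)] with s hs x
    rw [dist_comm]
    exact x.2.2 (t + 1) t s (lt_add_one t).le (le_of_lt hs)

/-- **Carathéodory's existence theorem** on a half-line, for a locally dominated right-hand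
side. -/
lemma exists_integral_solution {f : ℝ → ℝ → ℝ}
    (hf : Measurable (Function.uncurry f)) (hfc : ∀ t, Continuous (f t))
    (hb : ∀ T, ∃ h : ℝ → ℝ, Integrable h ∧ ∀ᵐ t, t ≤ T → ∀ x, |f t x| ≤ h t) (t₀ a : ℝ) :
    ∃ x : ℝ → ℝ, Continuous x ∧ ∀ t, t₀ ≤ t → x t = a + ∫ s in t₀..t, f s (x s) := by
  choose h hh hbd using hb
  have hb : ∀ T, ∃ h : ℝ → ℝ, Integrable h ∧ ∀ᵐ t, t ≤ T → ∀ x, |f t x| ≤ h t :=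
    fun T => ⟨h T, hh T, hbd T⟩
  have hδ : ∀ n : ℕ, (0 : ℝ) < 1 / ((n : ℝ) + 1) := fun n => Nat.one_div_pos_of_nat
  choose u τ hu hτ using fun n : ℕ => exists_euler_approximation hf hb t₀ a (hδ n)
  have hint : ∀ n p q, IntervalIntegrable (fun s => f s (u n s)) volume p q :=
    fun n p q => intervalIntegrable_comp_of_dominated hf hb (hu n) p q
  let y : ℕ → C(ℝ, ℝ) := fun n => ⟨fun t => a + ∫ s in t₀..t, f s (u n s),
    continuous_const.add (intervalIntegral.continuous_primitive (hint n) t₀)⟩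
  have hy : ∀ n t, y n t = a + ∫ s in t₀..t, f s (u n s) := fun _ _ => rfl
  obtain ⟨x, -, φ, hφ, hlim⟩ := (isCompact_setOf_modulus (fun T t => ∫ s in t₀..t, h T s)
    (fun T => (hh T).continuous_primitive t₀) t₀ a).tendsto_subseq (x := y) (by
      refine fun n => ⟨by simp [hy], fun T s t hs ht => ?_⟩
      have hH := intervalIntegral.integral_interval_sub_left (f := h T) (μ := volume)
        (a := t₀) (b := t) (c := s)
        (hh T).intervalIntegrable (hh T).intervalIntegrable
      rw [hy, hy, add_sub_add_left_eq_sub, intervalIntegral.integral_interval_sub_left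
        (hint n _ _) (hint n _ _), hH, ← Real.norm_eq_abs]
      refine intervalIntegral.norm_integral_le_abs_of_norm_le ?_ (hh T).intervalIntegrable
      filter_upwards [ae_restrict_of_ae (hbd T), ae_restrict_mem measurableSet_uIoc] with r hr hrm
      exact hr (hrm.2.trans (max_le hs ht)) _)
  have hloc := ContinuousMap.tendsto_iff_tendstoLocallyUniformly.1 hlim
  have hδ0 : Tendsto (fun n => 1 / ((φ n : ℝ) + 1)) atTop (𝓝 0) :=
    tendsto_one_div_add_atTop_nhds_zero_nat.comp hφ.tendsto_atTop
  have hulim : ∀ s, t₀ ≤ s → Tendsto (fun n => u (φ n) s) atTop (𝓝 (x s)) := by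
    intro s hs
    have hτlim : Tendsto (fun n => τ (φ n) s) atTop (𝓝 s) := by
      have h1 : Tendsto (fun n => s - 1 / ((φ n : ℝ) + 1)) atTop (𝓝 s) := by
        simpa using tendsto_const_nhds.sub hδ0
      refine tendsto_of_tendsto_of_tendsto_of_le_of_le h1 tendsto_const_nhds
        (fun n => ?_) (fun n => (hτ (φ n) s hs).1)
      have := (hτ (φ n) s hs).2.1
      simp only
      linarith
    refine (hloc.tendsto_comp x.continuous.continuousAt hτlim).congr fun n => ?_
    exact ((hτ (φ n) s hs).2.2.2).symm
  refine ⟨x, x.continuous, fun t ht => ?_⟩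
  refine tendsto_nhds_unique
    (((continuous_eval_const t).tendsto x).comp hlim) ?_
  refine Tendsto.add tendsto_const_nhds ?_
  refine intervalIntegral.tendsto_integral_filter_of_dominated_convergence (h t) ?_ ?_
    (hh t).intervalIntegrable ?_
  · exact Eventually.of_forall fun n =>
      (hf.comp (measurable_id.prodMk (hu (φ n)))).aestronglyMeasurable
  · refine Eventually.of_forall fun n => ?_
    filter_upwards [hbd t] with r hr hrm
    rw [uIoc_of_le ht] at hrm
    exact hr hrm.2 _
  · refine Eventually.of_forall fun r hr => ?_
    rw [uIoc_of_le ht] at hr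
    exact ((hfc r).tendsto _).comp (hulim r hr.1.le)

/-- Comparison principle: a nonincreasing function that starts below a continuous one stays below it
if it cannot gain on it while being above. -/
lemma le_of_antitoneOn_of_sub_le {Γ D : ℝ → ℝ} {t₀ : ℝ} (hD : Continuous D)
    (hΓ : AntitoneOn Γ (Ici t₀)) (h₀ : Γ t₀ ≤ D t₀)
    (h : ∀ s t, t₀ ≤ s → s ≤ t → (∀ r ∈ Ioc s t, D r < Γ r) → Γ t - Γ s ≤ D t - D s)
    {t : ℝ} (ht : t₀ ≤ t) : Γ t ≤ D t := by
  set A : Set ℝ := {s | s ∈ Icc t₀ t ∧ Γ s ≤ D s} with hA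
  have hne : A.Nonempty := ⟨t₀, ⟨le_rfl, ht⟩, h₀⟩
  have hbdd : BddAbove A := ⟨t, fun s hs => hs.1.2⟩
  have hs₀ : t₀ ≤ sSup A := le_csSup hbdd ⟨⟨le_rfl, ht⟩, h₀⟩
  have hst : sSup A ≤ t := csSup_le hne fun s hs => hs.1.2
  have hs : Γ (sSup A) ≤ D (sSup A) := by
    have hcl : IsClosed {r | Γ (sSup A) ≤ D r} := isClosed_le continuous_const hD
    refine closure_minimal (fun r hr => ?_) hcl (csSup_mem_closure hne hbdd)
    exact (hΓ hr.1.1 hs₀ (le_csSup hbdd hr)).trans hr.2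
  have := h _ t hs₀ hst fun r hr => by
    by_contra! hle
    exact absurd (le_csSup hbdd ⟨⟨hs₀.trans hr.1.le, hr.2⟩, hle⟩) (not_le.2 hr.1)
  linarith

/-- **Existence of a dominating solution of a Cauchy problem (infinite horizon).**
Under the assumptions of the finite-horizon lemma, now holding on every interval
`[t₀,T]`, with `g` integrable on `[t₀,∞)` and `γ` measurable, nonnegative and locally
bounded, there is a locally absolutely continuous `x` on `[t₀,∞)` with `x(t₀) = γ(t₀)`,
`x' = −ψ(·,x) + g` a.e., `γ ≤ x` on `[t₀,∞)`; in particular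
`limsup_{t→∞} γ(t) ≤ limsup_{t→∞} x(t)`. -/
theorem stmt_1 (t₀ : ℝ)
    (ψ : ℝ → ℝ → ℝ)
    (hψ_nonneg : ∀ t ∈ Ici t₀, ∀ x : ℝ, 0 ≤ ψ t x)
    (hψ_meas : ∀ x : ℝ, Measurable fun t => ψ t x)
    (hψ_cont : ∀ᵐ t ∂(volume.restrict (Ici t₀)), Continuous fun x => ψ t x)
    (hψ_bound : ∀ T > t₀, ∀ r > (0 : ℝ), ∃ k : ℝ → ℝ,
      IntegrableOn k (Icc t₀ T) ∧ (∀ t ∈ Icc t₀ T, 0 ≤ k t) ∧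
      ∀ᵐ t ∂(volume.restrict (Icc t₀ T)), ∀ x : ℝ, |x| ≤ r → ψ t x ≤ k t)
    (g : ℝ → ℝ) (hg : IntegrableOn g (Ici t₀))
    (γ : ℝ → ℝ) (hγ_meas : Measurable γ)
    (hγ_nonneg : ∀ t ∈ Ici t₀, 0 ≤ γ t)
    (hγ_locbdd : ∀ T > t₀, ∃ C : ℝ, ∀ t ∈ Icc t₀ T, γ t ≤ C)
    (hγ_ineq : ∀ t₁ t₂ : ℝ, t₀ ≤ t₁ → t₁ ≤ t₂ →
      γ t₂ - γ t₁ + ∫ t in t₁..t₂, ψ t (γ t) ≤ ∫ t in t₁..t₂, g t) :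
    ∃ x x' : ℝ → ℝ,
      (∀ T > t₀, IntegrableOn x' (Icc t₀ T)) ∧
      (∀ t ∈ Ici t₀, x t = x t₀ + ∫ s in t₀..t, x' s) ∧
      x t₀ = γ t₀ ∧
      (∀ᵐ t ∂(volume.restrict (Ici t₀)), x' t = -ψ t (x t) + g t) ∧
      (∀ t ∈ Ici t₀, γ t ≤ x t) ∧
      limsup γ atTop ≤ limsup x atTop := by
  have hbad : volume (Ici t₀ ∩ {t | ¬ Continuous (ψ t)}) = 0 := by
    have := ae_iff.1 hψ_cont
    rwa [Measure.restrict_apply' measurableSet_Ici, inter_comm] at this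
  set N := toMeasurable volume (Ici t₀ ∩ {t | ¬ Continuous (ψ t)}) with hN
  have hN0 : volume N = 0 := by rw [hN, measure_toMeasurable, hbad]
  have hZ : MeasurableSet (N ∪ Iio t₀) := (measurableSet_toMeasurable _ _).union measurableSet_Iio
  classical
  let Ψ : ℝ → ℝ → ℝ := fun t x => if t ∈ N ∪ Iio t₀ then 0 else ψ t x
  have hΨ_nonneg : ∀ t x, 0 ≤ Ψ t x := by
    intro t x
    by_cases h : t ∈ N ∪ Iio t₀
    · simp only [Ψ, if_pos h, le_refl]
    · simp only [Ψ, if_neg h]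
      exact hψ_nonneg t (not_lt.1 fun hlt : t < t₀ => h (Or.inr hlt)) x
  have hΨ_cont : ∀ t, Continuous (Ψ t) := by
    intro t
    by_cases h : t ∈ N ∪ Iio t₀
    · simp only [Ψ, if_pos h, continuous_const]
    · simp only [Ψ, if_neg h]
      by_contra hc
      exact h (Or.inl (subset_toMeasurable _ _ ⟨not_lt.1 fun hlt : t < t₀ => h (Or.inr hlt), hc⟩))
  have hΨ_meas : Measurable (Function.uncurry Ψ) := by
    have := measurable_uncurry_of_continuous_of_measurable (u := fun x t => Ψ t x) hΨ_cont
      fun x => Measurable.ite hZ measurable_const (hψ_meas x)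
    exact this.comp measurable_swap
  have hΨ_eq : ∀ᵐ t, t₀ ≤ t → ∀ x, Ψ t x = ψ t x := by
    filter_upwards [measure_eq_zero_iff_ae_notMem.1 hN0] with t ht ht₀ x
    have h : t ∉ N ∪ Iio t₀ := fun h => h.elim ht (not_lt.2 ht₀)
    simp only [Ψ, if_neg h]
  have hΨ_lt : ∀ t < t₀, ∀ x, Ψ t x = 0 := fun t ht x => if_pos (Or.inr ht)
  let G : ℝ → ℝ := (Ici t₀).indicator (hg.aestronglyMeasurable.mk g)
  have hG_meas : Measurable G :=
    hg.aestronglyMeasurable.stronglyMeasurable_mk.measurable.indicator measurableSet_Ici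
  have hG_eq : ∀ᵐ t, t₀ ≤ t → G t = g t := by
    filter_upwards [(ae_restrict_iff' measurableSet_Ici).1 hg.aestronglyMeasurable.ae_eq_mk]
      with t ht ht₀
    rw [ht ht₀]
    exact indicator_of_mem (show t ∈ Ici t₀ from ht₀) _
  have hG_int : Integrable G :=
    (integrable_indicator_iff measurableSet_Ici).2 (hg.congr hg.aestronglyMeasurable.ae_eq_mk)
  set M : ℝ := γ t₀ + ∫ t, |G t| with hM
  have hγ_ineq' : ∀ t₁ t₂ : ℝ, t₀ ≤ t₁ → t₁ ≤ t₂ →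
      γ t₂ - γ t₁ + ∫ t in t₁..t₂, Ψ t (γ t) ≤ ∫ t in t₁..t₂, G t := by
    intro t₁ t₂ h₁ h₂
    have e₁ : ∫ t in t₁..t₂, Ψ t (γ t) = ∫ t in t₁..t₂, ψ t (γ t) := by
      apply intervalIntegral.integral_congr_ae
      filter_upwards [hΨ_eq] with t ht htm
      rw [uIoc_of_le h₂] at htm
      exact ht (h₁.trans htm.1.le) _
    have e₂ : ∫ t in t₁..t₂, G t = ∫ t in t₁..t₂, g t := by
      apply intervalIntegral.integral_congr_ae
      filter_upwards [hG_eq] with t ht htm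
      rw [uIoc_of_le h₂] at htm
      exact ht (h₁.trans htm.1.le)
    rw [e₁, e₂]
    exact hγ_ineq t₁ t₂ h₁ h₂
  have hM_of_le : ∀ t y p, t₀ ≤ t → 0 ≤ p → y - γ t₀ + p ≤ ∫ s in t₀..t, G s → y ≤ M := by
    intro t y p ht hp hle
    have h₁ : ∫ s in t₀..t, G s ≤ ∫ s, |G s| := by
      rw [intervalIntegral.integral_of_le ht]
      calc ∫ s in Ioc t₀ t, G s ≤ ∫ s in Ioc t₀ t, |G s| :=
            integral_mono hG_int.integrableOn hG_int.abs.integrableOn fun s => le_abs_self _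
        _ ≤ ∫ s, |G s| :=
            setIntegral_le_integral hG_int.abs (Eventually.of_forall fun s => abs_nonneg _)
    linarith
  have hγM : ∀ t, t₀ ≤ t → γ t ≤ M := fun t ht =>
    hM_of_le t _ _ ht (intervalIntegral.integral_nonneg ht fun s _ => hΨ_nonneg _ _)
      (hγ_ineq' t₀ t le_rfl ht)
  have hM0 : 0 ≤ M := (hγ_nonneg t₀ self_mem_Ici).trans (hγM t₀ le_rfl)
  have hΨ_dom : ∀ T, ∃ k : ℝ → ℝ, Integrable k ∧
      ∀ᵐ t, t ≤ T → ∀ x, |x| ≤ M → |Ψ t x| ≤ k t := by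
    intro T
    obtain ⟨k, hk, hk0, hkb⟩ := hψ_bound (max T t₀ + 1)
      ((le_max_right T t₀).trans_lt (lt_add_one _)) (M + 1) (by linarith)
    refine ⟨(Icc t₀ (max T t₀ + 1)).indicator k,
      (integrable_indicator_iff measurableSet_Icc).2 hk, ?_⟩
    filter_upwards [hΨ_eq, (ae_restrict_iff' measurableSet_Icc).1 hkb] with t ht htk htT x hx
    rcases lt_or_ge t t₀ with h | h
    · rw [hΨ_lt t h, abs_zero]
      exact indicator_nonneg hk0 t
    · have hmem : t ∈ Icc t₀ (max T t₀ + 1) := ⟨h, by linarith [le_max_left T t₀]⟩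
      rw [indicator_of_mem hmem, abs_of_nonneg (hΨ_nonneg _ _), ht h]
      exact htk hmem x (by linarith)
  let f : ℝ → ℝ → ℝ := fun t x => G t - Ψ t (max (γ t) (min x M))
  have harg : ∀ t x, t₀ ≤ t → |max (γ t) (min x M)| ≤ M := by
    intro t x ht
    rw [abs_le]
    exact ⟨by linarith [hγ_nonneg t ht, le_max_left (γ t) (min x M)],
      max_le (hγM t ht) (min_le_right _ _)⟩
  have hf_meas : Measurable (Function.uncurry f) := by
    have h : Measurable fun p : ℝ × ℝ => max (γ p.1) (min p.2 M) :=
      (hγ_meas.comp measurable_fst).max (measurable_snd.min measurable_const)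
    exact (hG_meas.comp measurable_fst).sub (hΨ_meas.comp (measurable_fst.prodMk h))
  have hf_cont : ∀ t, Continuous (f t) := fun t =>
    continuous_const.sub ((hΨ_cont t).comp (by fun_prop))
  have hf_dom : ∀ T, ∃ h : ℝ → ℝ, Integrable h ∧ ∀ᵐ t, t ≤ T → ∀ x, |f t x| ≤ h t := by
    intro T
    obtain ⟨k, hk, hkb⟩ := hΨ_dom T
    refine ⟨fun t => |G t| + |k t|, hG_int.abs.add hk.abs, ?_⟩
    filter_upwards [hkb] with t ht htT x
    refine (abs_sub _ _).trans (add_le_add le_rfl ?_)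
    rcases lt_or_ge t t₀ with h | h
    · rw [hΨ_lt t h, abs_zero]
      exact abs_nonneg _
    · exact (ht htT _ (harg t x h)).trans (le_abs_self _)
  obtain ⟨x, hx_cont, hx⟩ := exists_integral_solution hf_meas hf_cont hf_dom t₀ (γ t₀)
  have hGi : ∀ p q, IntervalIntegrable G volume p q := fun p q => hG_int.intervalIntegrable
  have hfi : ∀ p q, IntervalIntegrable (fun s => f s (x s)) volume p q :=
    intervalIntegrable_comp_of_dominated hf_meas hf_dom hx_cont.measurable
  have hΨi : ∀ p q, IntervalIntegrable (fun s => Ψ s (max (γ s) (min (x s) M))) volume p q := by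
    intro p q
    refine ((hGi p q).sub (hfi p q)).congr fun s _ => ?_
    simp [f]
  have hx_diff : ∀ s t, t₀ ≤ s → s ≤ t →
      x t - x s + ∫ r in s..t, Ψ r (max (γ r) (min (x r) M)) = ∫ r in s..t, G r := by
    intro s t hs hst
    rw [hx t (hs.trans hst), hx s hs, add_sub_add_left_eq_sub,
      intervalIntegral.integral_interval_sub_left (hfi _ _) (hfi _ _),
      intervalIntegral.integral_sub (hGi s t) (hΨi s t)]
    ring
  have hx₀ : x t₀ = γ t₀ := by simpa using hx t₀ le_rfl
  have hxM : ∀ t, t₀ ≤ t → x t ≤ M := fun t ht =>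
    hM_of_le t _ _ ht (intervalIntegral.integral_nonneg ht fun s _ => hΨ_nonneg _ _)
      (hx₀ ▸ (hx_diff t₀ t le_rfl ht).le)
  have hGadd : ∀ s t, ∫ r in t₀..t, G r = (∫ r in t₀..s, G r) + ∫ r in s..t, G r :=
    fun s t => (intervalIntegral.integral_add_adjacent_intervals (hGi _ _) (hGi _ _)).symm
  have hγx : ∀ t, t₀ ≤ t → γ t ≤ x t := by
    intro t ht
    have := le_of_antitoneOn_of_sub_le (Γ := fun t => γ t - ∫ s in t₀..t, G s)
      (D := fun t => x t - ∫ s in t₀..t, G s) (t₀ := t₀)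
      (hx_cont.sub (hG_int.continuous_primitive t₀)) ?_ ?_ ?_ ht
    · simpa using this
    · intro s hs t ht hst
      have h₁ := hγ_ineq' s t hs hst
      have h₂ : 0 ≤ ∫ r in s..t, Ψ r (γ r) :=
        intervalIntegral.integral_nonneg hst fun s _ => hΨ_nonneg _ _
      simp only
      linarith [hGadd s t]
    · simp [hx₀]
    · intro s t hs hst hlt
      have h₁ := hγ_ineq' s t hs hst
      have h₂ := hx_diff s t hs hst
      have e : ∫ r in s..t, Ψ r (max (γ r) (min (x r) M)) = ∫ r in s..t, Ψ r (γ r) := by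
        apply intervalIntegral.integral_congr_ae (Eventually.of_forall fun r hr => ?_)
        rw [uIoc_of_le hst] at hr
        have hlt' : x r < γ r := by simpa using hlt r hr
        rw [max_eq_left ((min_le_left _ _).trans hlt'.le)]
      rw [e] at h₂
      linarith
  refine ⟨x, fun t => -ψ t (x t) + g t, ?_⟩
  have hx' : ∀ᵐ t, t₀ ≤ t → f t (x t) = -ψ t (x t) + g t := by
    filter_upwards [hΨ_eq, hG_eq] with t h₁ h₂ ht
    simp only [f]
    rw [min_eq_left (hxM t ht), max_eq_right (hγx t ht), h₁ ht, h₂ ht]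
    ring
  refine ⟨fun T hT => ?_, fun t ht => ?_, hx₀, Eventually.of_forall fun _ => rfl, hγx, ?_⟩
  · refine ((intervalIntegrable_iff_integrableOn_Icc_of_le hT.le).1 (hfi t₀ T)).congr ?_
    filter_upwards [ae_restrict_of_ae hx', ae_restrict_mem measurableSet_Icc] with t h₁ h₂
    exact h₁ h₂.1
  · rw [hx t ht, hx₀]
    congr 1
    apply intervalIntegral.integral_congr_ae
    filter_upwards [hx'] with s h₁ hs
    rw [uIoc_of_le ht] at hs
    exact h₁ hs.1.le
  · refine limsup_le_limsup ((eventually_ge_atTop t₀).mono hγx) ?_ ?_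
    · exact IsCoboundedUnder.of_frequently_ge (a := 0)
        ((eventually_ge_atTop t₀).mono hγ_nonneg).frequently
    · exact isBoundedUnder_of_eventually_le (a := M) ((eventually_ge_atTop t₀).mono hxM)
end

section
/- Let t₀ < T be real numbers. Let ψ : [t₀,T] × ℝ → [0,∞) be a Carathéodory function such that for every r > 0 there is a nonnegative integrable k_r with sup_{|x| ≤ r} ψ(t,x) ≤ k_r(t) a.e.; assume in addition that ψ(t,a) = 0 for all a ≤ 0, that x ↦ ψ(t,x) is increasing for a.e. t ∈ [t₀,T], and that for all R > r > 0 there exists a nonnegative integrable function k̄_{R,r} on [t₀,T] with |ψ(t,x) − ψ(t,y)| ≤ k̄_{R,r}(t)|x − y| for all x,y ∈ [r,R] and a.e. t. Let g be integrable and nonnegative on [t₀,T] and let γ : [t₀,T] → [0,∞) be measurable and bounded, satisfying γ(t₂) − γ(t₁) + ∫_{t₁}^{t₂} ψ(t,γ(t)) dt ≤ ∫_{t₁}^{t₂} g(t) dt for all t₀ ≤ t₁ ≤ t₂ ≤ T. Then the absolutely continuous solution z of z′(t) = −ψ(t,z(t)) a.e., z(t₀) = γ(t₀), is unique and defined on all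 of [t₀,T], satisfies z(t) ≥ 0 for all t, and every absolutely continuous function x on [t₀,T] with x(t₀) = γ(t₀), x′(t) = −ψ(t,x(t)) + g(t) a.e. and γ ≤ x on [t₀,T] satisfies γ(t) ≤ x(t) ≤ z(t) + ∫_{t₀}^{t} g(s) ds for all t ∈ [t₀,T]. -/
open MeasureTheory Set

/-- A primitive starting at a nonpositive value whose derivative is nonpositive wherever it is
positive stays nonpositive. -/
lemma primitive_nonpos_of_deriv_nonpos {a b : ℝ} {u u' : ℝ → ℝ} (hu' : IntegrableOn u' (Icc a b))
    (hu : ∀ t ∈ Icc a b, u t = u a + ∫ s in a..t, u' s) (ha : u a ≤ 0)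
    (h : ∀ᵐ t ∂(volume.restrict (Icc a b)), 0 < u t → u' t ≤ 0) :
    ∀ t ∈ Icc a b, u t ≤ 0 := by
  intro t ht
  by_contra! hpos
  have hcont : ContinuousOn u (Icc a b) := by
    have h1 := intervalIntegral.continuousOn_primitive_interval
      (a := a) (b := b) (f := u') (μ := volume) (by rwa [uIcc_of_le (ht.1.trans ht.2)])
    rw [uIcc_of_le (ht.1.trans ht.2)] at h1
    exact (continuousOn_const.add h1).congr hu
  have hsub : Icc a t ⊆ Icc a b := Icc_subset_Icc_right ht.2
  have hK : IsCompact (Icc a t ∩ u ⁻¹' Iic 0) :=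
    isCompact_Icc.of_isClosed_subset
      ((hcont.mono hsub).preimage_isClosed_of_isClosed isClosed_Icc isClosed_Iic)
      inter_subset_left
  obtain ⟨s, ⟨hs, hus⟩, hmax⟩ := hK.exists_isGreatest ⟨a, ⟨le_rfl, ht.1⟩, ha⟩
  have hint : ∀ p ∈ Icc a b, ∀ q ∈ Icc a b, IntervalIntegrable u' volume p q := fun p hp q hq =>
    (hu'.mono_set (ordConnected_Icc.uIcc_subset hp hq)).intervalIntegrable
  have haI : a ∈ Icc a b := ⟨le_rfl, ht.1.trans ht.2⟩
  have hdiff : u t - u s = ∫ r in s..t, u' r := by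
    rw [hu t ht, hu s (hsub hs), add_sub_add_left_eq_sub,
      intervalIntegral.integral_interval_sub_left (hint a haI t ht) (hint a haI s (hsub hs))]
  have hle : ∫ r in s..t, u' r ≤ 0 := by
    rw [intervalIntegral.integral_of_le hs.2]
    refine setIntegral_nonpos_of_ae_restrict ?_
    have h2 := ae_restrict_of_ae_restrict_of_subset
      ((Ioc_subset_Icc_self).trans (Icc_subset_Icc hs.1 ht.2) : Ioc s t ⊆ Icc a b) h
    filter_upwards [h2, ae_restrict_mem measurableSet_Ioc] with r hr hrm
    refine hr ?_
    by_contra! hneg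
    exact absurd (hmax ⟨⟨hs.1.trans hrm.1.le, hrm.2⟩, hneg⟩) (not_le.2 hrm.1)
  have hus' : u s ≤ 0 := hus
  linarith

section Existence

variable {φ : ℝ → ℝ → ℝ} {c : ℝ}

lemma integrable_comp_of_le (hmeas : ∀ x, Measurable fun t => φ t x)
    (hcont : ∀ t, Continuous (φ t)) (hmono : ∀ t, Monotone (φ t)) (hnonneg : ∀ t x, 0 ≤ φ t x)
    (hint : Integrable fun t => φ t c) {y : ℝ → ℝ} (hy : Measurable y) (hyc : ∀ t, y t ≤ c) :
    Integrable fun t => φ t (y t) := by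
  have hm : Measurable (Function.uncurry fun x t => φ t x) :=
    measurable_uncurry_of_continuous_of_measurable (u := fun x t => φ t x) hcont hmeas
  refine hint.mono' (hm.comp (hy.prodMk measurable_id)).aestronglyMeasurable
    (Filter.Eventually.of_forall fun t => ?_)
  rw [Real.norm_of_nonneg (hnonneg _ _)]
  exact hmono t (hyc t)

/-- Solution of the delayed equation `z'(t) = -φ(t, z(t - h))` on a half-line bounded above. -/
lemma exists_delayed_solution_aux (hmeas : ∀ x, Measurable fun t => φ t x)
    (hcont : ∀ t, Continuous (φ t)) (hmono : ∀ t, Monotone (φ t)) (hnonneg : ∀ t x, 0 ≤ φ t x)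
    (hint : Integrable fun t => φ t c) (t₀ : ℝ) {h : ℝ} (hh : 0 < h) (N : ℕ) :
    ∃ z : ℝ → ℝ, Continuous z ∧ (∀ t, z t ≤ c) ∧
      ∀ t ≤ t₀ + N * h, z t = c - ∫ s in t₀..max t₀ t, φ s (z (s - h)) := by
  induction N with
  | zero =>
    refine ⟨fun _ => c, continuous_const, fun _ => le_rfl, fun t ht => ?_⟩
    have : max t₀ t = t₀ := max_eq_left (by simpa using ht)
    simp [this]
  | succ N ih =>
    obtain ⟨z, hz, hzc, hzeq⟩ := ih
    have hI := integrable_comp_of_le hmeas hcont hmono hnonneg hint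
      (y := fun s => z (s - h)) (by fun_prop) fun s => hzc _
    refine ⟨fun t => c - ∫ s in t₀..max t₀ t, φ s (z (s - h)), ?_, fun t => ?_, fun t ht => ?_⟩
    · exact continuous_const.sub ((intervalIntegral.continuous_primitive
        (fun _ _ => hI.intervalIntegrable) t₀).comp (by fun_prop))
    · exact sub_le_self _ (intervalIntegral.integral_nonneg (le_max_left _ _)
        fun s _ => hnonneg _ _)
    · refine congrArg (c - ·) (intervalIntegral.integral_congr fun s hs => ?_)
      rw [uIcc_of_le (le_max_left _ _)] at hs
      have hs' : s - h ≤ t₀ + N * h := by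
        have h1 := hs.2
        push_cast at ht
        rcases max_choice t₀ t with h2 | h2 <;> rw [h2] at h1
        · nlinarith [Nat.cast_nonneg (α := ℝ) N]
        · linarith
      exact congrArg (φ s) (hzeq _ hs')

lemma exists_delayed_solution (hmeas : ∀ x, Measurable fun t => φ t x)
    (hcont : ∀ t, Continuous (φ t)) (hmono : ∀ t, Monotone (φ t)) (hnonneg : ∀ t x, 0 ≤ φ t x)
    (hint : Integrable fun t => φ t c) (t₀ T : ℝ) {h : ℝ} (hh : 0 < h) :
    ∃ z : ℝ → ℝ, Continuous z ∧ (∀ t, z t ≤ c) ∧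
      ∀ t ≤ T, z t = c - ∫ s in t₀..max t₀ t, φ s (z (s - h)) := by
  obtain ⟨N, hN⟩ := exists_nat_ge ((T - t₀) / h)
  obtain ⟨z, hz, hzc, hzeq⟩ :=
    exists_delayed_solution_aux hmeas hcont hmono hnonneg hint t₀ hh N
  refine ⟨z, hz, hzc, fun t ht => hzeq t ?_⟩
  rw [div_le_iff₀ hh] at hN
  linarith

/-- Existence for `z' = -φ(t, z)`, `z(t₀) = c`, with `φ` of Carathéodory type, nonnegative and
increasing in the second variable. -/
lemma exists_solution_of_monotone (hmeas : ∀ x, Measurable fun t => φ t x)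
    (hcont : ∀ t, Continuous (φ t)) (hmono : ∀ t, Monotone (φ t)) (hnonneg : ∀ t x, 0 ≤ φ t x)
    (hint : Integrable fun t => φ t c) {t₀ T : ℝ} (hT : t₀ ≤ T) :
    ∃ z : ℝ → ℝ, IntegrableOn (fun t => φ t (z t)) (Icc t₀ T) ∧
      ∀ t ∈ Icc t₀ T, z t = c - ∫ s in t₀..t, φ s (z s) := by
  have hpos : ∀ n : ℕ, (0 : ℝ) < 1 / ((n : ℝ) + 1) := fun n => by positivity
  choose z hz hzc hzeq using fun n =>
    exists_delayed_solution hmeas hcont hmono hnonneg hint t₀ T (hpos n)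
  set y : ℕ → ℝ → ℝ := fun n s => z n (s - 1 / ((n : ℝ) + 1))
  have hyc : ∀ n s, y n s ≤ c := fun n s => hzc _ _
  have hI : ∀ n, Integrable fun s => φ s (y n s) := fun n =>
    integrable_comp_of_le hmeas hcont hmono hnonneg hint
      ((hz n).measurable.comp (measurable_id.sub_const _)) (hyc n)
  have hII : ∀ n p q, IntervalIntegrable (fun s => φ s (y n s)) volume p q := fun n p q =>
    (hI n).intervalIntegrable
  have hzeq' : ∀ n, ∀ t ∈ Icc t₀ T, z n t = c - ∫ s in t₀..t, φ s (y n s) := by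
    intro n t ht
    rw [hzeq n t ht.2, max_eq_right ht.1]
  have hyz : ∀ n, ∀ s ∈ Icc t₀ T, z n s ≤ y n s ∧
      y n s - z n s ≤ ∫ r in max t₀ (s - 1 / ((n : ℝ) + 1))..s, φ r c := by
    intro n s hs
    have hle : max t₀ (s - 1 / ((n : ℝ) + 1)) ≤ s := max_le hs.1 (by linarith [hpos n])
    have heq : y n s - z n s = ∫ r in max t₀ (s - 1 / ((n : ℝ) + 1))..s, φ r (y n r) := by
      have := hzeq n (s - 1 / ((n : ℝ) + 1)) (by linarith [hpos n, hs.2])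
      change y n s = c - ∫ r in t₀..max t₀ (s - 1 / ((n : ℝ) + 1)), φ r (y n r) at this
      rw [this, hzeq' n s hs, sub_sub_sub_cancel_left,
        intervalIntegral.integral_interval_sub_left (hII n _ _) (hII n _ _)]
    constructor
    · have : 0 ≤ y n s - z n s := heq ▸ intervalIntegral.integral_nonneg hle
        fun r _ => hnonneg _ _
      linarith
    · rw [heq]
      exact intervalIntegral.integral_mono_on hle (hII n _ _) hint.intervalIntegrable
        fun r _ => hmono r (hyc n r)
  have hdelay : ∀ ε > 0, ∃ n₀ : ℕ, ∀ n ≥ n₀, ∀ s ∈ Icc t₀ T, y n s ≤ z n s + ε := by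
    intro ε hε
    have hK : Continuous fun t => ∫ r in t₀..t, φ r c :=
      intervalIntegral.continuous_primitive (fun _ _ => hint.intervalIntegrable) t₀
    have hU := (isCompact_Icc (a := t₀) (b := T)).uniformContinuousOn_of_continuous hK.continuousOn
    rw [Metric.uniformContinuousOn_iff] at hU
    obtain ⟨δ, hδ, hU⟩ := hU ε hε
    obtain ⟨n₀, hn₀⟩ := exists_nat_one_div_lt hδ
    refine ⟨n₀, fun n hn s hs => ?_⟩
    have hnδ : 1 / ((n : ℝ) + 1) < δ := (Nat.one_div_le_one_div hn).trans_lt hn₀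
    have hle : max t₀ (s - 1 / ((n : ℝ) + 1)) ≤ s := max_le hs.1 (by linarith [hpos n])
    have h1 := hU s hs (max t₀ (s - 1 / ((n : ℝ) + 1))) ⟨le_max_left _ _, hle.trans hs.2⟩ (by
      rw [Real.dist_eq, abs_of_nonneg (by linarith)]
      linarith [le_max_right t₀ (s - 1 / ((n : ℝ) + 1))])
    rw [Real.dist_eq, intervalIntegral.integral_interval_sub_left hint.intervalIntegrable
      hint.intervalIntegrable] at h1
    linarith [(abs_lt.1 h1).2, (hyz n s hs).2]
  have hcomp : ∀ ε > 0, ∃ n₀ : ℕ, ∀ m ≥ n₀, ∀ n, ∀ t ∈ Icc t₀ T, z n t ≤ z m t + ε := by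
    intro ε hε
    obtain ⟨n₀, hn₀⟩ := hdelay ε hε
    refine ⟨n₀, fun m hm n t ht => ?_⟩
    have h0 : ∀ k, z k t₀ = c := fun k => by simpa using hzeq' k t₀ ⟨le_rfl, hT⟩
    have := primitive_nonpos_of_deriv_nonpos (a := t₀) (b := T) (u := fun t => z n t - z m t - ε)
      (u' := fun s => φ s (y m s) - φ s (y n s)) ((hI m).sub (hI n)).integrableOn
      (fun t ht => by
        simp only [h0]
        rw [intervalIntegral.integral_sub (hII m _ _) (hII n _ _), hzeq' n t ht, hzeq' m t ht]
        ring)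
      (by simp only [h0]; linarith)
      (by
        filter_upwards [ae_restrict_mem measurableSet_Icc] with s hs hlt
        refine sub_nonpos.2 (hmono s ?_)
        linarith [hn₀ m hm s hs, (hyz n s hs).1])
      t ht
    linarith
  have hlim : ∀ t ∈ Icc t₀ T, ∃ l, Filter.Tendsto (fun n => z n t) Filter.atTop (nhds l) := by
    intro t ht
    refine cauchySeq_tendsto_of_complete (Metric.cauchySeq_iff.2 fun ε hε => ?_)
    obtain ⟨n₀, hn₀⟩ := hcomp (ε / 2) (by positivity)
    refine ⟨n₀, fun m hm n hn => ?_⟩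
    rw [Real.dist_eq, abs_lt]
    constructor <;> linarith [hn₀ m hm n t ht, hn₀ n hn m t ht]
  choose! w hw using hlim
  have hyw : ∀ t ∈ Icc t₀ T, Filter.Tendsto (fun n => y n t) Filter.atTop (nhds (w t)) := by
    intro t ht
    have h1 : Filter.Tendsto (fun n => y n t - z n t) Filter.atTop (nhds 0) := by
      refine Metric.tendsto_atTop.2 fun ε hε => ?_
      obtain ⟨n₀, hn₀⟩ := hdelay (ε / 2) (by positivity)
      refine ⟨n₀, fun n hn => ?_⟩
      rw [Real.dist_eq, abs_lt]
      constructor <;> linarith [hn₀ n hn t ht, (hyz n t ht).1]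
    simpa using h1.add (hw t ht)
  have hφw : ∀ t ∈ Icc t₀ T,
      Filter.Tendsto (fun n => φ t (y n t)) Filter.atTop (nhds (φ t (w t))) := fun t ht =>
    ((hcont t).tendsto _).comp (hyw t ht)
  have hbd : ∀ n t, ‖φ t (y n t)‖ ≤ φ t c := fun n t => by
    rw [Real.norm_of_nonneg (hnonneg _ _)]
    exact hmono t (hyc n t)
  refine ⟨w, ?_, fun t ht => ?_⟩
  · refine Integrable.mono' hint.integrableOn (aestronglyMeasurable_of_tendsto_ae Filter.atTop
      (fun n => (hI n).aestronglyMeasurable.restrict) ?_) ?_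
    · filter_upwards [ae_restrict_mem measurableSet_Icc] with t ht using hφw t ht
    · filter_upwards [ae_restrict_mem measurableSet_Icc] with t ht
      exact le_of_tendsto (hφw t ht).norm (Filter.Eventually.of_forall fun n => hbd n t)
  · have h1 : Filter.Tendsto (fun n => ∫ s in t₀..t, φ s (y n s)) Filter.atTop
        (nhds (∫ s in t₀..t, φ s (w s))) := by
      refine intervalIntegral.tendsto_integral_filter_of_dominated_convergence (fun s => φ s c)
        (Filter.Eventually.of_forall fun n => (hI n).aestronglyMeasurable.restrict)
        (Filter.Eventually.of_forall fun n => Filter.Eventually.of_forall fun s _ => hbd n s)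
        hint.intervalIntegrable (Filter.Eventually.of_forall fun s hs => ?_)
      rw [uIoc_of_le ht.1] at hs
      exact hφw s ⟨hs.1.le, hs.2.trans ht.2⟩
    refine tendsto_nhds_unique (hw t ht) ?_
    simpa only [hzeq' _ t ht] using h1.const_sub c

end Existence

/-- **Comparison with the homogeneous Cauchy problem.**
Under the assumptions of the finite-horizon Gronwall-type lemma, together with:
`ψ(t,a) = 0` for `a ≤ 0`, `ψ(t,·)` increasing for a.e. `t`, a local Lipschitz
condition on `[r,R]` with integrable constants, and `g ≥ 0`, the (absolutely
continuous) solution `z` of `z' = −ψ(·,z)`, `z(t₀) = γ(t₀)` is unique, defined on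
all of `[t₀,T]`, nonnegative, and every absolutely continuous solution `x` of
`x' = −ψ(·,x) + g`, `x(t₀) = γ(t₀)` with `γ ≤ x` satisfies
`γ(t) ≤ x(t) ≤ z(t) + ∫_{t₀}^t g(s) ds` on `[t₀,T]`. -/
theorem stmt_2 (t₀ T : ℝ) (hT : t₀ < T)
    (ψ : ℝ → ℝ → ℝ)
    (hψ_nonneg : ∀ t ∈ Icc t₀ T, ∀ x : ℝ, 0 ≤ ψ t x)
    (hψ_meas : ∀ x : ℝ, Measurable fun t => ψ t x)
    (hψ_cont : ∀ᵐ t ∂(volume.restrict (Icc t₀ T)), Continuous fun x => ψ t x)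
    (hψ_bound : ∀ r > (0 : ℝ), ∃ k : ℝ → ℝ,
      IntegrableOn k (Icc t₀ T) ∧ (∀ t ∈ Icc t₀ T, 0 ≤ k t) ∧
      ∀ᵐ t ∂(volume.restrict (Icc t₀ T)), ∀ x : ℝ, |x| ≤ r → ψ t x ≤ k t)
    (hψ_zero : ∀ t ∈ Icc t₀ T, ∀ a : ℝ, a ≤ 0 → ψ t a = 0)
    (hψ_incr : ∀ᵐ t ∂(volume.restrict (Icc t₀ T)), ∀ x y : ℝ, x ≤ y → ψ t x ≤ ψ t y)
    (hψ_lip : ∀ R r : ℝ, 0 < r → r < R → ∃ kbar : ℝ → ℝ,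
      IntegrableOn kbar (Icc t₀ T) ∧ (∀ t ∈ Icc t₀ T, 0 ≤ kbar t) ∧
      ∀ᵐ t ∂(volume.restrict (Icc t₀ T)),
        ∀ x ∈ Icc r R, ∀ y ∈ Icc r R, |ψ t x - ψ t y| ≤ kbar t * |x - y|)
    (g : ℝ → ℝ) (hg : IntegrableOn g (Icc t₀ T)) (hg_nonneg : ∀ t ∈ Icc t₀ T, 0 ≤ g t)
    (γ : ℝ → ℝ) (hγ_meas : Measurable γ)
    (hγ_nonneg : ∀ t ∈ Icc t₀ T, 0 ≤ γ t)
    (hγ_bdd : ∃ C : ℝ, ∀ t ∈ Icc t₀ T, γ t ≤ C)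
    (hγ_ineq : ∀ t₁ t₂ : ℝ, t₀ ≤ t₁ → t₁ ≤ t₂ → t₂ ≤ T →
      γ t₂ - γ t₁ + ∫ t in t₁..t₂, ψ t (γ t) ≤ ∫ t in t₁..t₂, g t) :
    ∃ z z' : ℝ → ℝ,
      -- `z` is an absolutely continuous solution of `z' = −ψ(·,z)`, `z(t₀) = γ(t₀)`,
      -- well defined on all of `[t₀,T]` and nonnegative:
      IntegrableOn z' (Icc t₀ T) ∧
      (∀ t ∈ Icc t₀ T, z t = z t₀ + ∫ s in t₀..t, z' s) ∧
      z t₀ = γ t₀ ∧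
      (∀ᵐ t ∂(volume.restrict (Icc t₀ T)), z' t = -ψ t (z t)) ∧
      (∀ t ∈ Icc t₀ T, 0 ≤ z t) ∧
      -- uniqueness of `z`:
      (∀ w w' : ℝ → ℝ,
        IntegrableOn w' (Icc t₀ T) →
        (∀ t ∈ Icc t₀ T, w t = w t₀ + ∫ s in t₀..t, w' s) →
        w t₀ = γ t₀ →
        (∀ᵐ t ∂(volume.restrict (Icc t₀ T)), w' t = -ψ t (w t)) →
        ∀ t ∈ Icc t₀ T, w t = z t) ∧
      -- every dominating solution `x` of the inhomogeneous problem is squeezed: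
      (∀ x x' : ℝ → ℝ,
        IntegrableOn x' (Icc t₀ T) →
        (∀ t ∈ Icc t₀ T, x t = x t₀ + ∫ s in t₀..t, x' s) →
        x t₀ = γ t₀ →
        (∀ᵐ t ∂(volume.restrict (Icc t₀ T)), x' t = -ψ t (x t) + g t) →
        (∀ t ∈ Icc t₀ T, γ t ≤ x t) →
        ∀ t ∈ Icc t₀ T, γ t ≤ x t ∧ x t ≤ z t + ∫ s in t₀..t, g s) := by
  have hI : ∀ {f : ℝ → ℝ}, IntegrableOn f (Icc t₀ T) → ∀ t ∈ Icc t₀ T,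
      IntervalIntegrable f volume t₀ t := fun hf t ht =>
    (hf.mono_set (by rw [uIcc_of_le ht.1]; exact Icc_subset_Icc_right ht.2)).intervalIntegrable
  obtain ⟨z, hzi, hz, hz0⟩ : ∃ z : ℝ → ℝ, IntegrableOn (fun t => ψ t (z t)) (Icc t₀ T) ∧
      (∀ t ∈ Icc t₀ T, z t = z t₀ + ∫ s in t₀..t, -ψ s (z s)) ∧ z t₀ = γ t₀ := by
    obtain ⟨S, hSsub, hSm, hSae⟩ : ∃ S ⊆ Icc t₀ T ∩
        {t | Continuous (ψ t) ∧ Monotone (ψ t)}, MeasurableSet S ∧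
        ∀ᵐ t ∂(volume.restrict (Icc t₀ T)), t ∈ S := by
      have h : Icc t₀ T ∩ {t | Continuous (ψ t) ∧ Monotone (ψ t)} ∈
          ae (volume.restrict (Icc t₀ T)) := by
        filter_upwards [hψ_cont, hψ_incr, ae_restrict_mem measurableSet_Icc] with t h1 h2 h3
        exact ⟨h3, h1, fun x y => h2 x y⟩
      obtain ⟨S, hS, hSm, hSsub⟩ := (inferInstance :
        (ae (volume.restrict (Icc t₀ T))).IsMeasurablyGenerated).exists_measurable_subset h
      exact ⟨S, hSsub, hSm, hS⟩
    set φ : ℝ → ℝ → ℝ := fun t x => S.indicator (fun t => ψ t x) t with hφ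
    have hin : ∀ {t}, t ∈ S → φ t = ψ t := fun ht => funext fun x => indicator_of_mem ht _
    have hout : ∀ {t}, t ∉ S → φ t = fun _ => 0 := fun ht =>
      funext fun x => indicator_of_notMem ht _
    have hint : Integrable fun t => φ t (γ t₀) := by
      obtain ⟨k, hk, -, hkb⟩ := hψ_bound (|γ t₀| + 1) (by positivity)
      rw [hφ]
      refine (integrable_indicator_iff hSm).2 (IntegrableOn.mono_set ?_
        (hSsub.trans inter_subset_left))
      refine Integrable.mono' hk (hψ_meas _).aestronglyMeasurable ?_
      filter_upwards [hkb, ae_restrict_mem measurableSet_Icc] with t h1 h2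
      rw [Real.norm_of_nonneg (hψ_nonneg t h2 _)]
      exact h1 _ (by linarith)
    obtain ⟨z, hzi, hz⟩ := exists_solution_of_monotone (φ := φ) (c := γ t₀)
      (fun x => (hψ_meas x).indicator hSm)
      (fun t => by
        by_cases ht : t ∈ S
        · rw [hin ht]; exact (hSsub ht).2.1
        · rw [hout ht]; exact continuous_const)
      (fun t => by
        by_cases ht : t ∈ S
        · rw [hin ht]; exact (hSsub ht).2.2
        · rw [hout ht]; exact monotone_const)
      (fun t x => indicator_nonneg (fun s hs => hψ_nonneg s (hSsub hs).1 x) t)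
      hint hT.le
    have hae : (fun t => φ t (z t)) =ᵐ[volume.restrict (Icc t₀ T)] fun t => ψ t (z t) := by
      filter_upwards [hSae] with t ht
      rw [hin ht]
    have hz0 : z t₀ = γ t₀ := by simpa using hz t₀ ⟨le_rfl, hT.le⟩
    refine ⟨z, hzi.congr hae, fun t ht => ?_, hz0⟩
    rw [hz t ht, hz0, intervalIntegral.integral_neg, ← sub_eq_add_neg,
      intervalIntegral.integral_of_le ht.1, intervalIntegral.integral_of_le ht.1]
    congr 1
    exact integral_congr_ae (ae_restrict_of_ae_restrict_of_subset
      (Ioc_subset_Icc_self.trans (Icc_subset_Icc_right ht.2)) hae)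
  have hcmp : ∀ v v' w w' : ℝ → ℝ, IntegrableOn v' (Icc t₀ T) → IntegrableOn w' (Icc t₀ T) →
      (∀ t ∈ Icc t₀ T, v t = v t₀ + ∫ s in t₀..t, v' s) →
      (∀ t ∈ Icc t₀ T, w t = w t₀ + ∫ s in t₀..t, w' s) → v t₀ = w t₀ →
      (∀ᵐ t ∂(volume.restrict (Icc t₀ T)), w t < v t → v' t ≤ w' t) →
      ∀ t ∈ Icc t₀ T, v t ≤ w t := by
    intro v v' w w' hv' hw' hv hw h0 h t ht
    have := primitive_nonpos_of_deriv_nonpos (u := fun t => v t - w t) (u' := fun t => v' t - w' t)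
      (hv'.sub hw')
      (fun t ht => by
        rw [intervalIntegral.integral_sub (hI hv' t ht) (hI hw' t ht), hv t ht, hw t ht]
        ring)
      (by simp [h0])
      (by
        filter_upwards [h] with t h1 h2
        exact sub_nonpos.2 (h1 (sub_pos.1 h2))) t ht
    exact sub_nonpos.1 this
  have hzn : IntegrableOn (fun t => -ψ t (z t)) (Icc t₀ T) := hzi.neg
  refine ⟨z, fun t => -ψ t (z t), hzn, hz, hz0, Filter.Eventually.of_forall fun _ => rfl,
    ?_, ?_, ?_⟩
  · intro t ht
    have := primitive_nonpos_of_deriv_nonpos (u := fun t => -z t) (u' := fun t => ψ t (z t)) hzi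
      (fun t ht => by
        rw [hz t ht, intervalIntegral.integral_neg]
        ring)
      (by simpa [hz0] using hγ_nonneg t₀ ⟨le_rfl, hT.le⟩)
      (by
        filter_upwards [ae_restrict_mem measurableSet_Icc] with s hs hlt
        exact (hψ_zero s hs _ (by linarith)).le) t ht
    simpa using this
  · intro w w' hw' hw hw0 hwae t ht
    refine le_antisymm (hcmp w w' z _ hw' hzn hw hz (hw0.trans hz0.symm) ?_ t ht)
      (hcmp z _ w w' hzn hw' hz hw (hz0.trans hw0.symm) ?_ t ht)
    · filter_upwards [hwae, hψ_incr] with s h1 h2 h3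
      rw [h1]
      exact neg_le_neg (h2 _ _ h3.le)
    · filter_upwards [hwae, hψ_incr] with s h1 h2 h3
      rw [h1]
      exact neg_le_neg (h2 _ _ h3.le)
  · intro x x' hx' hx hx0 hxae hγx t ht
    refine ⟨hγx t ht, hcmp x x' (fun t => z t + ∫ s in t₀..t, g s) (fun t => -ψ t (z t) + g t) hx'
      (hzn.add hg) hx (fun t ht => ?_) (by simp [hx0, hz0]) ?_ t ht⟩
    · simp only [intervalIntegral.integral_same, add_zero]
      rw [intervalIntegral.integral_add (hI hzn t ht) (hI hg t ht), hz t ht]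
      ring
    · filter_upwards [hxae, hψ_incr, ae_restrict_mem measurableSet_Icc] with s h1 h2 hs h3
      have hg0 : 0 ≤ ∫ r in t₀..s, g r := intervalIntegral.integral_nonneg hs.1
        fun r hr => hg_nonneg r ⟨hr.1, hr.2.trans hs.2⟩
      rw [h1]
      have := h2 (z s) (x s) (by linarith)
      linarith
end

section
/- Let Ω be a bounded open subset of ℝ^N, let 1 < p < ∞, and let f ∈ L^{p,∞}(Ω). Then lim_{k→∞} ‖f − 𝒯_k f‖_{p,∞} = dist_{L^{p,∞}(Ω)}(f, L^∞(Ω)), where 𝒯_k is the truncation operator at height k. -/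
open MeasureTheory Set ENNReal

/-- The distribution function `λ_f(k) = |{x ∈ Ω : |f(x)| > k}|` (Lebesgue measure). -/
noncomputable def distribFn {N : ℕ} (Ω : Set (EuclideanSpace ℝ (Fin N)))
    (f : EuclideanSpace ℝ (Fin N) → ℝ) (k : ℝ) : ℝ≥0∞ :=
  volume {x ∈ Ω | k < |f x|}

/-- The Marcinkiewicz (weak-`L^p`) quasinorm `‖f‖_{p,∞} = sup_{k>0} k λ_f(k)^{1/p}`. -/
noncomputable def weakNorm {N : ℕ} (Ω : Set (EuclideanSpace ℝ (Fin N)))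
    (p : ℝ) (f : EuclideanSpace ℝ (Fin N) → ℝ) : ℝ≥0∞ :=
  ⨆ k : ℝ, ⨆ _ : 0 < k, ENNReal.ofReal k * distribFn Ω f k ^ (1 / p)

/-- The distance of `f` to `L^∞(Ω)` in the `L^{p,∞}(Ω)` quasinorm. -/
noncomputable def distLinf {N : ℕ} (Ω : Set (EuclideanSpace ℝ (Fin N)))
    (p : ℝ) (f : EuclideanSpace ℝ (Fin N) → ℝ) : ℝ≥0∞ :=
  ⨅ g : {g : EuclideanSpace ℝ (Fin N) → ℝ //
      Measurable g ∧ ∃ C : ℝ, ∀ x ∈ Ω, |g x| ≤ C},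
    weakNorm Ω p (fun x => f x - g.1 x)

/-- The truncation operator at height `k`: `𝒯_k y = (y/|y|) min{|y|,k}`. -/
noncomputable def truncAt (k y : ℝ) : ℝ := max (-k) (min y k)

/-- The weak-`L^p` quasinorm is monotone in the absolute value of the function. -/
theorem weakNorm_mono {N : ℕ} {Ω : Set (EuclideanSpace ℝ (Fin N))} {p : ℝ} (hp : 0 ≤ p)
    {f g : EuclideanSpace ℝ (Fin N) → ℝ} (h : ∀ x ∈ Ω, |f x| ≤ |g x|) :
    weakNorm Ω p f ≤ weakNorm Ω p g := by
  refine iSup₂_mono fun k _ => ?_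
  have hle : distribFn Ω f k ≤ distribFn Ω g k :=
    measure_mono fun x hx => ⟨hx.1, hx.2.trans_le (h x hx.1)⟩
  exact mul_le_mul_right (ENNReal.rpow_le_rpow hle (by positivity)) _

theorem abs_truncAt_le (k y : ℝ) : |truncAt k y| ≤ |k| := by
  unfold truncAt
  grind

theorem measurable_truncAt (k : ℝ) : Measurable (truncAt k) := by
  unfold truncAt
  fun_prop

/-- Truncation at height `k` is a best approximation among the numbers bounded by `k`. -/
theorem abs_sub_truncAt_le {k y z : ℝ} (hz : |z| ≤ k) : |y - truncAt k y| ≤ |y - z| := by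
  unfold truncAt
  grind

/-- **Truncations realize the distance to `L^∞` in `L^{p,∞}`.**
For `f ∈ L^{p,∞}(Ω)`, `1 < p < ∞`, one has
`lim_{k→∞} ‖f − 𝒯_k f‖_{p,∞} = dist_{L^{p,∞}(Ω)}(f, L^∞(Ω))`. -/
theorem stmt_4 (N : ℕ) (hN : 1 ≤ N)
    (Ω : Set (EuclideanSpace ℝ (Fin N))) (hΩ_open : IsOpen Ω)
    (hΩ_bdd : Bornology.IsBounded Ω)
    (p : ℝ) (hp : 1 < p)
    (f : EuclideanSpace ℝ (Fin N) → ℝ) (hf_meas : Measurable f)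
    (hf : weakNorm Ω p f < ⊤) :
    Filter.Tendsto (fun k => weakNorm Ω p (fun x => f x - truncAt k (f x)))
      Filter.atTop (nhds (distLinf Ω p f)) := by
  refine tendsto_order.2 ⟨fun a ha => .of_forall fun k => ha.trans_le ?_, fun a ha => ?_⟩
  · exact iInf_le_of_le ⟨fun x => truncAt k (f x), (measurable_truncAt k).comp hf_meas,
      |k|, fun x _ => abs_truncAt_le k (f x)⟩ le_rfl
  · obtain ⟨⟨g, _, C, hC⟩, hga⟩ := iInf_lt_iff.1 ha
    filter_upwards [Filter.eventually_ge_atTop C] with k hk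
    exact (weakNorm_mono (by linarith) fun x hx =>
      abs_sub_truncAt_le ((hC x hx).trans hk)).trans_lt hga
end

section
/- Let Ω be a bounded open subset of ℝ^N with 0 ∈ Ω, let B > 0, and let b(x) := B/|x| for x ∈ Ω \ {0}. Then dist_{L^{N,∞}(Ω)}(b, L^∞(Ω)) = B ω_N^{1/N}, where ω_N is the Lebesgue measure of the unit ball of ℝ^N. -/
open MeasureTheory Set ENNReal

theorem volume_ball_rpow_one_div {N : ℕ} (hN : 1 ≤ N) {r : ℝ} (hr : 0 < r) :
    volume (Metric.ball (0 : EuclideanSpace ℝ (Fin N)) r) ^ (1 / (N : ℝ)) =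
      ENNReal.ofReal r *
        volume (Metric.ball (0 : EuclideanSpace ℝ (Fin N)) 1) ^ (1 / (N : ℝ)) := by
  have hN' : N ≠ 0 := by omega
  rw [Measure.addHaar_ball_of_pos _ _ hr, finrank_euclideanSpace_fin,
    ENNReal.mul_rpow_of_nonneg _ _ (by positivity), ENNReal.ofReal_pow hr.le, one_div,
    ENNReal.pow_rpow_inv_natCast hN']

/-- The Marcinkiewicz quasinorm of a function bounded by `B / ‖x‖` off the origin. -/
theorem weakNorm_le_of_abs_le_div_norm {N : ℕ} (hN : 1 ≤ N)
    {Ω : Set (EuclideanSpace ℝ (Fin N))} {B : ℝ} (hB : 0 < B)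
    {f : EuclideanSpace ℝ (Fin N) → ℝ} (hf : ∀ x ∈ Ω \ {0}, |f x| ≤ B / ‖x‖) :
    weakNorm Ω (N : ℝ) f ≤ ENNReal.ofReal B *
      volume (Metric.ball (0 : EuclideanSpace ℝ (Fin N)) 1) ^ (1 / (N : ℝ)) := by
  have : Nonempty (Fin N) := ⟨⟨0, hN⟩⟩
  refine iSup₂_le fun k hk => ?_
  have hsub : {x ∈ Ω | k < |f x|} ⊆
      Metric.ball (0 : EuclideanSpace ℝ (Fin N)) (B / k) := by
    rintro x ⟨hx, hkx⟩
    by_cases hx0 : x = 0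
    · subst hx0
      exact Metric.mem_ball_self (by positivity)
    · have hpos : 0 < ‖x‖ := norm_pos_iff.2 hx0
      have h := hkx.trans_le (hf x ⟨hx, hx0⟩)
      rw [lt_div_iff₀ hpos] at h
      rw [mem_ball_zero_iff, lt_div_iff₀ hk]
      linarith
  calc ENNReal.ofReal k * distribFn Ω f k ^ (1 / (N : ℝ))
      ≤ ENNReal.ofReal k *
          volume (Metric.ball (0 : EuclideanSpace ℝ (Fin N)) (B / k)) ^ (1 / (N : ℝ)) := by
        unfold distribFn
        gcongr
    _ = _ := by
        rw [volume_ball_rpow_one_div hN (by positivity), ← mul_assoc,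
          ← ENNReal.ofReal_mul hk.le, mul_div_cancel₀ _ hk.ne']

/-- A lower bound for the quasinorm of a function that is at least `B / ‖x‖ - C` near `0`. -/
theorem le_weakNorm_of_div_norm_sub_le_abs {N : ℕ} (hN : 1 ≤ N)
    {Ω : Set (EuclideanSpace ℝ (Fin N))} (hΩ : Ω ∈ nhds 0) {B C : ℝ} (hB : 0 < B) (hC : 0 ≤ C)
    {f : EuclideanSpace ℝ (Fin N) → ℝ} (hf : ∀ x ∈ Ω \ {0}, B / ‖x‖ - C ≤ |f x|) :
    ENNReal.ofReal B *
      volume (Metric.ball (0 : EuclideanSpace ℝ (Fin N)) 1) ^ (1 / (N : ℝ)) ≤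
      weakNorm Ω (N : ℝ) f := by
  have : Nonempty (Fin N) := ⟨⟨0, hN⟩⟩
  obtain ⟨ε, hε, hball⟩ := Metric.mem_nhds_iff.1 hΩ
  have hlim : Filter.Tendsto (fun k : ℝ => B - B * C / (k + C)) Filter.atTop (nhds B) := by
    have h := (Filter.tendsto_atTop_add_const_right Filter.atTop C
      Filter.tendsto_id).const_div_atTop (B * C)
    simpa using h.const_sub B
  have hfin : volume (Metric.ball (0 : EuclideanSpace ℝ (Fin N)) 1) ^ (1 / (N : ℝ)) ≠ ⊤ :=
    ENNReal.rpow_ne_top_of_nonneg (by positivity) measure_ball_lt_top.ne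
  refine le_of_tendsto (ENNReal.Tendsto.mul_const (ENNReal.tendsto_ofReal hlim)
    (Or.inr hfin)) ?_
  filter_upwards [Filter.eventually_gt_atTop 0, Filter.eventually_ge_atTop (B / ε)]
    with k hk hkε
  have hkC : 0 < k + C := by positivity
  have hr : B / (k + C) ≤ ε := by
    rw [div_le_iff₀ hε] at hkε
    rw [div_le_iff₀ hkC]
    nlinarith
  have hsub : Metric.ball (0 : EuclideanSpace ℝ (Fin N)) (B / (k + C)) \ {0} ⊆
      {x ∈ Ω | k < |f x|} := by
    rintro x ⟨hx, hx0⟩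
    have hxΩ : x ∈ Ω := hball (Metric.ball_subset_ball hr hx)
    have hpos : 0 < ‖x‖ := norm_pos_iff.2 hx0
    refine ⟨hxΩ, lt_of_lt_of_le ?_ (hf x ⟨hxΩ, hx0⟩)⟩
    rw [mem_ball_zero_iff, lt_div_iff₀ hkC] at hx
    rw [lt_sub_iff_add_lt, lt_div_iff₀ hpos]
    linarith
  calc ENNReal.ofReal (B - B * C / (k + C)) *
        volume (Metric.ball (0 : EuclideanSpace ℝ (Fin N)) 1) ^ (1 / (N : ℝ))
      = ENNReal.ofReal k * volume
          (Metric.ball (0 : EuclideanSpace ℝ (Fin N)) (B / (k + C)) \ {0}) ^ (1 / (N : ℝ)) := by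
        rw [measure_sdiff_null (measure_singleton _), volume_ball_rpow_one_div hN (r := B / (k + C)) (by positivity),
          ← mul_assoc, ← ENNReal.ofReal_mul hk.le]
        congr 2
        field_simp
        ring
    _ ≤ ENNReal.ofReal k * distribFn Ω f k ^ (1 / (N : ℝ)) := by
        unfold distribFn
        gcongr
    _ ≤ weakNorm Ω (N : ℝ) f :=
        le_iSup₂ (f := fun k (_ : 0 < k) =>
          ENNReal.ofReal k * distribFn Ω f k ^ (1 / (N : ℝ))) k hk

/-- **Distance of `B/|x|` to `L^∞`.** If `Ω ⊂ ℝ^N` is bounded open with `0 ∈ Ω` and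
`b(x) = B/|x|`, then `dist_{L^{N,∞}(Ω)}(b, L^∞(Ω)) = B ω_N^{1/N}`,
with `ω_N` the measure of the unit ball of `ℝ^N`. -/
theorem stmt_5 (N : ℕ) (hN : 1 ≤ N)
    (Ω : Set (EuclideanSpace ℝ (Fin N))) (hΩ_open : IsOpen Ω)
    (hΩ_bdd : Bornology.IsBounded Ω) (h0 : (0 : EuclideanSpace ℝ (Fin N)) ∈ Ω)
    (B : ℝ) (hB : 0 < B)
    (b : EuclideanSpace ℝ (Fin N) → ℝ) (hb : ∀ x ∈ Ω \ {0}, b x = B / ‖x‖) :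
    distLinf Ω (N : ℝ) b =
      ENNReal.ofReal
        (B * (volume (Metric.ball (0 : EuclideanSpace ℝ (Fin N)) 1)).toReal ^ (1 / (N : ℝ))) := by
  have hrhs : ENNReal.ofReal
      (B * (volume (Metric.ball (0 : EuclideanSpace ℝ (Fin N)) 1)).toReal ^ (1 / (N : ℝ))) =
      ENNReal.ofReal B *
        volume (Metric.ball (0 : EuclideanSpace ℝ (Fin N)) 1) ^ (1 / (N : ℝ)) := by
    rw [ENNReal.ofReal_mul hB.le, ENNReal.toReal_rpow, ENNReal.ofReal_toReal
      (ENNReal.rpow_ne_top_of_nonneg (by positivity) measure_ball_lt_top.ne)]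
  rw [hrhs]
  apply le_antisymm
  · refine (iInf_le _ ⟨fun _ => 0, measurable_const, 0, by simp⟩).trans ?_
    refine weakNorm_le_of_abs_le_div_norm hN hB fun x hx => ?_
    rw [sub_zero, hb x hx, abs_of_nonneg (by positivity)]
  · refine le_iInf ?_
    rintro ⟨g, -, C, hC⟩
    refine le_weakNorm_of_div_norm_sub_le_abs hN (hΩ_open.mem_nhds h0) hB
      ((abs_nonneg _).trans (hC 0 h0)) fun x hx => ?_
    have hg := (le_abs_self (g x)).trans (hC x hx.1)
    refine le_trans ?_ (le_abs_self _)
    rw [hb x hx]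
    linarith
end

section
/- Let p > 2, M > 0, C ≥ 0, a ≥ 0 and T > 0. Let g be a nonnegative integrable function on [0,T] and let x : [0,T] → [0,∞) be absolutely continuous with x(0) = a and x′(t) ≤ −M x(t)^{p/2} + C g(t) for a.e. t ∈ [0,T]. Then for every t ∈ [0,T], x(t) ≤ a / [1 + (p/2 − 1) M a^{(p−2)/2} t]^{2/(p−2)} + C ∫₀^t g(s) ds. -/
open MeasureTheory Set

/-- An absolutely continuous function that starts nonpositive and has nonpositive derivative a.e.
where it is positive stays nonpositive. -/
theorem nonpos_of_deriv_nonpos_of_pos {T : ℝ} {w w' : ℝ → ℝ}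
    (hw'_int : IntegrableOn w' (Icc 0 T))
    (hw_ac : ∀ t ∈ Icc 0 T, w t = w 0 + ∫ s in (0 : ℝ)..t, w' s)
    (hw0 : w 0 ≤ 0)
    (hw' : ∀ᵐ t ∂(volume.restrict (Icc 0 T)), 0 < w t → w' t ≤ 0) :
    ∀ t ∈ Icc 0 T, w t ≤ 0 := by
  intro t ht
  by_contra! hpos
  have hcont : ContinuousOn w (Icc 0 T) := by
    have h := intervalIntegral.continuousOn_primitive_interval
      (μ := volume) (f := w') (a := 0) (b := T) (by rwa [uIcc_of_le (ht.1.trans ht.2)])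
    rw [uIcc_of_le (ht.1.trans ht.2)] at h
    exact (continuousOn_const.add h).congr hw_ac
  have hsub : Icc 0 t ⊆ Icc 0 T := Icc_subset_Icc_right ht.2
  let S : Set ℝ := Icc 0 t ∩ w ⁻¹' Iic 0
  have hS_closed : IsClosed S := (hcont.mono hsub).preimage_isClosed_of_isClosed isClosed_Icc
    isClosed_Iic
  have hS_ne : S.Nonempty := ⟨0, ⟨le_rfl, ht.1⟩, hw0⟩
  have hS_bdd : BddAbove S := ⟨t, fun s hs => hs.1.2⟩
  obtain ⟨⟨hr0, hrt⟩, hwr⟩ := hS_closed.csSup_mem hS_ne hS_bdd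
  set r := sSup S
  have hpos_after : ∀ s ∈ Ioc r t, 0 < w s := fun s hs => by
    by_contra! hs'
    exact absurd (le_csSup hS_bdd ⟨⟨hr0.trans hs.1.le, hs.2⟩, hs'⟩) (not_le.2 hs.1)
  have hint : ∀ s ∈ Icc 0 T, IntervalIntegrable w' volume 0 s := fun s hs =>
    (intervalIntegrable_iff_integrableOn_Icc_of_le hs.1).2
      (hw'_int.mono_set (Icc_subset_Icc_right hs.2))
  have hrT : r ∈ Icc 0 T := ⟨hr0, hrt.trans ht.2⟩
  have hdiff : w t - w r = ∫ s in r..t, w' s := by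
    rw [hw_ac t ht, hw_ac r hrT, ← intervalIntegral.integral_interval_sub_left (hint t ht)
      (hint r hrT)]
    ring
  have hle : ∫ s in r..t, w' s ≤ 0 := by
    rw [intervalIntegral.integral_of_le hrt]
    apply integral_nonpos_of_ae
    have h := ae_restrict_of_ae_restrict_of_subset
      (fun s (hs : s ∈ Ioc r t) => (⟨hr0.trans hs.1.le, hs.2.trans ht.2⟩ : s ∈ Icc 0 T)) hw'
    filter_upwards [h, ae_restrict_mem measurableSet_Ioc] with s hs hs'
    exact hs (hpos_after s hs')
  have : w r ≤ 0 := hwr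
  linarith

/-- The decay profile `a / (1 + (p / 2 - 1) M a ^ ((p - 2) / 2) t) ^ (2 / (p - 2))` solves
`y' = -M y ^ (p / 2)`. -/
theorem hasDerivAt_decay_profile {p M a t : ℝ} (hp : 2 < p) (hM : 0 < M) (ha : 0 ≤ a)
    (ht : 0 ≤ t) :
    HasDerivAt (fun t => a / (1 + (p / 2 - 1) * M * a ^ ((p - 2) / 2) * t) ^ (2 / (p - 2)))
      (-M * (a / (1 + (p / 2 - 1) * M * a ^ ((p - 2) / 2) * t) ^ (2 / (p - 2))) ^ (p / 2)) t := by
  have hp2 : p - 2 ≠ 0 := by linarith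
  set k := (p / 2 - 1) * M * a ^ ((p - 2) / 2) with hk
  have hk0 : 0 ≤ k :=
    mul_nonneg (mul_nonneg (by linarith) hM.le) (Real.rpow_nonneg ha _)
  have hu : 0 < 1 + k * t := by positivity
  have ha_pow : a ^ (p / 2) = a * a ^ ((p - 2) / 2) := by
    rcases ha.eq_or_lt with rfl | ha
    · rw [Real.zero_rpow (by linarith), zero_mul]
    · rw [← Real.rpow_one_add' ha.le (by linarith)]
      congr 1
      ring
  have hlin : HasDerivAt (fun t => 1 + k * t) k t := by
    simpa using ((hasDerivAt_id t).const_mul k).const_add 1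
  have hder := (hlin.rpow_const (p := 2 / (p - 2)) (Or.inl hu.ne')).fun_inv
    (Real.rpow_pos_of_pos hu _).ne' |>.const_mul a
  simp only [← div_eq_mul_inv] at hder
  refine hder.congr_deriv ?_
  rw [Real.div_rpow ha (Real.rpow_nonneg hu.le _), ← Real.rpow_mul hu.le, ha_pow,
    show 2 / (p - 2) * (p / 2) = 2 / (p - 2) + 1 by field_simp; ring, Real.rpow_add hu,
    Real.rpow_sub hu, Real.rpow_one]
  have := (Real.rpow_pos_of_pos hu (2 / (p - 2))).ne'
  have hu' := hu.ne'
  field_simp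
  rw [hk]
  ring

/-- **Decay estimate, superquadratic case `p > 2`.** If `x : [0,T] → [0,∞)` is
absolutely continuous, `x(0) = a`, and `x'(t) ≤ −M x(t)^{p/2} + C g(t)` a.e. with
`g ≥ 0` integrable, then
`x(t) ≤ a/[1 + (p/2 − 1) M a^{(p−2)/2} t]^{2/(p−2)} + C ∫₀^t g`. -/
theorem stmt_11 (p M C a T : ℝ) (hp : 2 < p) (hM : 0 < M) (hC : 0 ≤ C) (ha : 0 ≤ a)
    (hT : 0 < T)
    (g : ℝ → ℝ) (hg_int : IntegrableOn g (Icc 0 T)) (hg_nonneg : ∀ t ∈ Icc 0 T, 0 ≤ g t)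
    (x x' : ℝ → ℝ)
    (hx_nonneg : ∀ t ∈ Icc 0 T, 0 ≤ x t)
    (hx'_int : IntegrableOn x' (Icc 0 T))
    (hx_ac : ∀ t ∈ Icc 0 T, x t = x 0 + ∫ s in (0 : ℝ)..t, x' s)
    (hx0 : x 0 = a)
    (hx' : ∀ᵐ t ∂(volume.restrict (Icc 0 T)), x' t ≤ -M * x t ^ (p / 2) + C * g t) :
    ∀ t ∈ Icc 0 T,
      x t ≤ a / (1 + (p / 2 - 1) * M * a ^ ((p - 2) / 2) * t) ^ (2 / (p - 2)) +
        C * ∫ s in (0 : ℝ)..t, g s := by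
  set y : ℝ → ℝ := fun t =>
    a / (1 + (p / 2 - 1) * M * a ^ ((p - 2) / 2) * t) ^ (2 / (p - 2)) with hy
  have hy_nonneg : ∀ t ∈ Icc 0 T, 0 ≤ y t := fun t ht =>
    div_nonneg ha (Real.rpow_nonneg (add_nonneg zero_le_one (mul_nonneg
      (mul_nonneg (mul_nonneg (by linarith) hM.le) (Real.rpow_nonneg ha _)) ht.1)) _)
  have hy_deriv : ∀ t ∈ Icc 0 T, HasDerivAt y (-M * y t ^ (p / 2)) t := fun t ht =>
    hasDerivAt_decay_profile hp hM ha ht.1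
  have hy'_cont : ContinuousOn (fun t => -M * y t ^ (p / 2)) (Icc 0 T) :=
    continuousOn_const.mul (ContinuousOn.rpow_const
      (fun t ht => (hy_deriv t ht).continuousAt.continuousWithinAt)
      fun _ _ => Or.inr (by linarith))
  have hy0 : y 0 = a := by simp [hy]
  have hint : ∀ {f : ℝ → ℝ}, IntegrableOn f (Icc 0 T) → ∀ t ∈ Icc 0 T,
      IntervalIntegrable f volume 0 t := fun hf t ht =>
    (intervalIntegrable_iff_integrableOn_Icc_of_le ht.1).2
      (hf.mono_set (Icc_subset_Icc_right ht.2))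
  have hy'_int : IntegrableOn (fun t => -M * y t ^ (p / 2)) (Icc 0 T) :=
    hy'_cont.integrableOn_Icc
  have hy_ac : ∀ t ∈ Icc 0 T, ∫ s in (0 : ℝ)..t, -M * y s ^ (p / 2) = y t - a := fun t ht => by
    rw [← hy0]
    refine intervalIntegral.integral_eq_sub_of_hasDerivAt (fun s hs => hy_deriv s ?_)
      (hint hy'_int t ht)
    rw [uIcc_of_le ht.1] at hs
    exact ⟨hs.1, hs.2.trans ht.2⟩
  have hw := nonpos_of_deriv_nonpos_of_pos (T := T)
    (w := fun t => x t - y t - C * ∫ s in (0 : ℝ)..t, g s)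
    (w' := fun t => x' t - -M * y t ^ (p / 2) - C * g t)
    ((hx'_int.sub hy'_int).sub (hg_int.const_mul C)) ?_ ?_ ?_
  · intro t ht
    have := hw t ht
    linarith
  · intro t ht
    rw [intervalIntegral.integral_sub ((hint hx'_int t ht).sub (hint hy'_int t ht))
        ((hint hg_int t ht).const_mul C),
      intervalIntegral.integral_sub (hint hx'_int t ht) (hint hy'_int t ht),
      intervalIntegral.integral_const_mul C, hy_ac t ht, hx_ac t ht, hx0, hy0,
      intervalIntegral.integral_same]
    ring
  · simp [hx0, hy0]
  · filter_upwards [hx', ae_restrict_mem measurableSet_Icc] with t hxt ht hpos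
    have hG : 0 ≤ C * ∫ s in (0 : ℝ)..t, g s :=
      mul_nonneg hC (intervalIntegral.integral_nonneg ht.1 fun s hs =>
        hg_nonneg s ⟨hs.1, hs.2.trans ht.2⟩)
    have hyx : y t ^ (p / 2) ≤ x t ^ (p / 2) :=
      Real.rpow_le_rpow (hy_nonneg t ht) (by linarith) (by linarith)
    have := mul_le_mul_of_nonneg_left hyx hM.le
    linarith
end
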